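/- arXiv:2303.05277 — 2 statements merged into one kernel-verified Lean document; each statement's English description precedes it below -/
import Mathlib

section
/- Fix C > 300. Let D > 1 be a squarefree fundamental discriminant and let ψ be the associated primitive quadratic character modulo D. Let q be a prime with D^{300} ≤ q ≤ D^{C}, set X := D^{20}, and for each Dirichlet character χ modulo q define the mollifier M(χ) := Σ_{n ≤ X, D ∤ n} (μ ∗ μψ)(n)·χ(n)/√n. Then Σ_{χ mod q, χ ≠ χ₀} |L(1/2, χψ)·M(χ)|² ≪ φ(q)·(log q)^{9}, where χ₀ is the principal character modulo q and the implied constant depends only on C. -/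
open Complex DirichletCharacter Finset

/-- `e(x) = exp(2πix)`. -/
noncomputable def eFun (x : ℝ) : ℂ := Complex.exp (2 * Real.pi * Complex.I * x)

/-- The root number `ε(χ) = τ(χ)/N^{1/2}` of a Dirichlet character mod `N`
(the terms with `(a, N) > 1` vanish since `χ a = 0` there). -/
noncomputable def epsChar {N : ℕ} [NeZero N] (χ : DirichletCharacter ℂ N) : ℂ :=
  (Real.sqrt N : ℂ)⁻¹ * ∑ a : ZMod N, χ a * eFun ((a.val : ℝ) / N)

/-- The product of a character mod `q` and a character mod `D`, as a character mod `q * D`. -/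
noncomputable def prodChar {q D : ℕ} (χ : DirichletCharacter ℂ q)
    (ψ : DirichletCharacter ℂ D) : DirichletCharacter ℂ (q * D) :=
  changeLevel (dvd_mul_right q D) χ * changeLevel (dvd_mul_left D q) ψ


/-- The Dirichlet convolution `(μ ∗ μψ)(n) = Σ_{ab = n} μ(a)·μ(b)ψ(b)`. -/
noncomputable def mollifierCoeff {D : ℕ} (ψ : DirichletCharacter ℂ D) (n : ℕ) : ℂ :=
  ∑ d ∈ n.divisors, ((ArithmeticFunction.moebius d : ℤ) : ℂ) *
    ((ArithmeticFunction.moebius (n / d) : ℤ) : ℂ) * ψ ((n / d : ℕ) : ZMod D)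

/-- The mollifier `M(χ) = Σ_{n ≤ X, D ∤ n} (μ ∗ μψ)(n) χ(n) / √n`. -/
noncomputable def mollifier {q D : ℕ} (ψ : DirichletCharacter ℂ D) (X : ℕ)
    (χ : DirichletCharacter ℂ q) : ℂ :=
  ∑ n ∈ Finset.Icc 1 X, if ¬ D ∣ n then
    mollifierCoeff ψ n * χ ((n : ℕ) : ZMod q) / (Real.sqrt n : ℂ) else 0

/-- The Dirichlet convolution of two real-valued functions on `ℕ`. -/
noncomputable def dirConv (u v : ℕ → ℝ) (n : ℕ) : ℝ :=
  ∑ p ∈ n.divisorsAntidiagonal, u p.1 * v p.2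

lemma dirConv_nonneg {u v : ℕ → ℝ} (hu : ∀ n, 0 ≤ u n) (hv : ∀ n, 0 ≤ v n) (n : ℕ) :
    0 ≤ dirConv u v n :=
  Finset.sum_nonneg fun _ _ => mul_nonneg (hu _) (hv _)

/-- The convolution of nonnegative submultiplicative functions is submultiplicative. -/
lemma dirConv_mul_le {u v : ℕ → ℝ} (hu : ∀ n, 0 ≤ u n) (hv : ∀ n, 0 ≤ v n)
    (hu' : ∀ m n, u (m * n) ≤ u m * u n) (hv' : ∀ m n, v (m * n) ≤ v m * v n) (m n : ℕ) :
    dirConv u v (m * n) ≤ dirConv u v m * dirConv u v n := by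
  classical
  unfold dirConv
  rw [Finset.sum_mul_sum, ← Finset.sum_product']
  let g : (ℕ × ℕ) × (ℕ × ℕ) → ℕ × ℕ := fun x => (x.1.1 * x.2.1, x.1.2 * x.2.2)
  have hsub : (m * n).divisorsAntidiagonal ⊆
      (m.divisorsAntidiagonal ×ˢ n.divisorsAntidiagonal).image g := by
    rintro ⟨a, b⟩ hab
    obtain ⟨hab, h0⟩ := Nat.mem_divisorsAntidiagonal.1 hab
    obtain ⟨a₁, a₂, ⟨b₁, rfl⟩, ⟨b₂, rfl⟩, rfl⟩ := exists_dvd_and_dvd_of_dvd_mul (Dvd.intro b hab)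
    have h0' : a₁ * a₂ ≠ 0 := by rintro h; simp [h] at hab; grind
    refine Finset.mem_image.2 ⟨((a₁, b₁), (a₂, b₂)), ?_, ?_⟩
    · simp only [Finset.mem_product, Nat.mem_divisorsAntidiagonal, true_and]
      exact ⟨fun h => h0 (by simp [h]), fun h => h0 (by simp [h])⟩
    · refine Prod.ext rfl (Nat.eq_of_mul_eq_mul_left (Nat.pos_of_ne_zero h0') ?_)
      simp only [g]
      rw [hab]; ring
  calc ∑ p ∈ (m * n).divisorsAntidiagonal, u p.1 * v p.2
      ≤ ∑ p ∈ (m.divisorsAntidiagonal ×ˢ n.divisorsAntidiagonal).image g, u p.1 * v p.2 :=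
        Finset.sum_le_sum_of_subset_of_nonneg hsub fun _ _ _ => mul_nonneg (hu _) (hv _)
    _ ≤ ∑ x ∈ m.divisorsAntidiagonal ×ˢ n.divisorsAntidiagonal, u (g x).1 * v (g x).2 :=
        Finset.sum_image_le_of_nonneg fun _ _ => mul_nonneg (hu _) (hv _)
    _ ≤ _ := Finset.sum_le_sum fun x _ => by
        calc u (g x).1 * v (g x).2 ≤ (u x.1.1 * u x.2.1) * (v x.1.2 * v x.2.2) :=
              mul_le_mul (hu' _ _) (hv' _ _) (hv _) (mul_nonneg (hu _) (hu _))
          _ = _ := by ring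

/-- Truncated Euler-product type bound for logarithmic sums of a convolution against a
submultiplicative weight. -/
lemma sum_dirConv_mul_div_le {u v w : ℕ → ℝ} (hu : ∀ n, 0 ≤ u n) (hv : ∀ n, 0 ≤ v n)
    (hw : ∀ n, 0 ≤ w n) (hw' : ∀ m n, w (m * n) ≤ w m * w n) (Q : ℕ) :
    ∑ n ∈ Icc 1 Q, dirConv u v n * w n / n ≤
      (∑ n ∈ Icc 1 Q, u n * w n / n) * ∑ n ∈ Icc 1 Q, v n * w n / n := by
  classical
  rw [Finset.sum_mul_sum, ← Finset.sum_product']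
  simp_rw [dirConv, Finset.sum_mul, Finset.sum_div]
  rw [Finset.sum_sigma']
  calc ∑ x ∈ (Icc 1 Q).sigma fun n => n.divisorsAntidiagonal, u x.2.1 * v x.2.2 * w x.1 / x.1
      = ∑ p ∈ ((Icc 1 Q).sigma fun n => n.divisorsAntidiagonal).image (fun x => x.2),
          u p.1 * v p.2 * w (p.1 * p.2) / ((p.1 * p.2 : ℕ) : ℝ) := by
        rw [Finset.sum_image]
        · refine Finset.sum_congr rfl fun x hx => ?_
          rw [(Nat.mem_divisorsAntidiagonal.1 (Finset.mem_sigma.1 hx).2).1]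
        · rintro ⟨n, p⟩ hx ⟨n', p'⟩ hy (rfl : p = p')
          have h1 := (Nat.mem_divisorsAntidiagonal.1 (Finset.mem_sigma.1 hx).2).1
          have h2 := (Nat.mem_divisorsAntidiagonal.1 (Finset.mem_sigma.1 hy).2).1
          simp only at h1 h2
          rw [← h1, ← h2]
    _ ≤ ∑ p ∈ Icc 1 Q ×ˢ Icc 1 Q, u p.1 * v p.2 * w (p.1 * p.2) / ((p.1 * p.2 : ℕ) : ℝ) := by
        refine Finset.sum_le_sum_of_subset_of_nonneg ?_ fun p _ _ => ?_
        · intro p hp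
          obtain ⟨⟨n, p⟩, hx, rfl⟩ := Finset.mem_image.1 hp
          obtain ⟨h1, h2⟩ := Finset.mem_sigma.1 hx
          obtain ⟨h3, h4⟩ := Nat.mem_divisorsAntidiagonal.1 h2
          simp only [mem_Icc] at h1 h3 ⊢
          simp only [Finset.mem_product, mem_Icc]
          have ha : 0 < p.1 := Nat.pos_of_ne_zero (by rintro h; simp [h] at h3; omega)
          have hb : 0 < p.2 := Nat.pos_of_ne_zero (by rintro h; simp [h] at h3; omega)
          exact ⟨⟨ha, by nlinarith⟩, ⟨hb, by nlinarith⟩⟩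
        · have := hu p.1; have := hv p.2; have := hw (p.1 * p.2); positivity
    _ ≤ _ := Finset.sum_le_sum fun p _ => by
        have h1 := hu p.1; have h2 := hv p.2; have h3 := hw' p.1 p.2
        calc u p.1 * v p.2 * w (p.1 * p.2) / ((p.1 * p.2 : ℕ) : ℝ)
            ≤ u p.1 * v p.2 * (w p.1 * w p.2) / ((p.1 * p.2 : ℕ) : ℝ) := by gcongr
          _ = _ := by push_cast; rw [div_mul_div_comm]; ring

/-- The divisor function, as a real-valued function. -/
noncomputable def divTwo : ℕ → ℝ := dirConv (fun _ => 1) fun _ => 1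

/-- The ternary divisor function, as a real-valued function. -/
noncomputable def divThree : ℕ → ℝ := dirConv (fun _ => 1) divTwo

lemma divTwo_nonneg (n : ℕ) : 0 ≤ divTwo n :=
  dirConv_nonneg (fun _ => zero_le_one) (fun _ => zero_le_one) n

lemma divThree_nonneg (n : ℕ) : 0 ≤ divThree n :=
  dirConv_nonneg (fun _ => zero_le_one) divTwo_nonneg n

lemma divTwo_mul_le (m n : ℕ) : divTwo (m * n) ≤ divTwo m * divTwo n :=
  dirConv_mul_le (fun _ => zero_le_one) (fun _ => zero_le_one) (fun _ _ => by simp)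
    (fun _ _ => by simp) m n

lemma divThree_mul_le (m n : ℕ) : divThree (m * n) ≤ divThree m * divThree n :=
  dirConv_mul_le (fun _ => zero_le_one) divTwo_nonneg (fun _ _ => by simp) divTwo_mul_le m n

lemma divTwo_eq_card (n : ℕ) : divTwo n = n.divisors.card := by
  rw [divTwo, dirConv, ← Nat.map_div_right_divisors]
  simp

lemma sum_divThree_sq_div_le (Q : ℕ) :
    ∑ n ∈ Icc 1 Q, divThree n ^ 2 / n ≤ (∑ n ∈ Icc 1 Q, (1 : ℝ) / n) ^ 9 := by
  set H := ∑ n ∈ Icc 1 Q, (1 : ℝ) / n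
  have hpos : ∀ w : ℕ → ℝ, (∀ n, 0 ≤ w n) → 0 ≤ ∑ n ∈ Icc 1 Q, w n / n := fun w hw =>
    Finset.sum_nonneg fun n _ => div_nonneg (hw n) n.cast_nonneg
  have h1 : ∑ n ∈ Icc 1 Q, divTwo n / n ≤ H * H := by
    have h := sum_dirConv_mul_div_le (u := fun _ => 1) (v := fun _ => 1) (w := fun _ => 1)
      (by simp) (by simp) (by simp) (by simp) Q
    simp only [mul_one] at h
    exact h
  have h2 : ∑ n ∈ Icc 1 Q, divThree n / n ≤ H * ∑ n ∈ Icc 1 Q, divTwo n / n := by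
    have h := sum_dirConv_mul_div_le (u := fun _ => 1) (v := divTwo) (w := fun _ => 1)
      (by simp) divTwo_nonneg (by simp) (by simp) Q
    simp only [mul_one] at h
    exact h
  set T := ∑ n ∈ Icc 1 Q, divThree n / n
  have h3 : ∑ n ∈ Icc 1 Q, divTwo n * divThree n / n ≤ T * T := by
    have h := sum_dirConv_mul_div_le (u := fun _ => 1) (v := fun _ => 1) (w := divThree)
      (by simp) (by simp) divThree_nonneg divThree_mul_le Q
    simp only [one_mul] at h
    exact h
  have h4 : ∑ n ∈ Icc 1 Q, divThree n * divThree n / n ≤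
      T * ∑ n ∈ Icc 1 Q, divTwo n * divThree n / n := by
    have h := sum_dirConv_mul_div_le (u := fun _ => 1) (v := divTwo) (w := divThree)
      (by simp) divTwo_nonneg divThree_nonneg divThree_mul_le Q
    simp only [one_mul] at h
    exact h
  have hH : 0 ≤ H := hpos (fun _ => 1) (by simp)
  have hT : 0 ≤ T := hpos _ divThree_nonneg
  have hT' : T ≤ H ^ 3 := by
    calc T ≤ H * (H * H) := h2.trans (by gcongr)
      _ = H ^ 3 := by ring
  calc ∑ n ∈ Icc 1 Q, divThree n ^ 2 / n = ∑ n ∈ Icc 1 Q, divThree n * divThree n / n := by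
        simp_rw [sq]
    _ ≤ T * (T * T) := h4.trans (by gcongr)
    _ = T ^ 3 := by ring
    _ ≤ (H ^ 3) ^ 3 := by gcongr
    _ = H ^ 9 := by ring

lemma sum_one_div_le_one_add_log (Q : ℕ) : ∑ n ∈ Icc 1 Q, (1 : ℝ) / n ≤ 1 + Real.log Q := by
  have h := harmonic_le_one_add_log Q
  rw [harmonic_eq_sum_Icc] at h
  simpa using h

/-- Orthogonality of the characters modulo `q`, for Dirichlet polynomials of length `< q`. -/
lemma sum_norm_sq_dirichletPolynomial {q : ℕ} [NeZero q] (hq : q.Prime) (c : ℕ → ℂ) :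
    ∑ χ : DirichletCharacter ℂ q, ‖∑ n ∈ Icc 1 (q - 1), c n * χ (n : ZMod q)‖ ^ 2 =
      q.totient * ∑ n ∈ Icc 1 (q - 1), ‖c n‖ ^ 2 := by
  classical
  have hunit : ∀ n ∈ Icc 1 (q - 1), IsUnit (n : ZMod q) := by
    intro n hn
    rw [mem_Icc] at hn
    rw [ZMod.isUnit_iff_coprime, Nat.coprime_comm, hq.coprime_iff_not_dvd]
    exact Nat.not_dvd_of_pos_of_lt (by omega) (by omega)
  have hstar : ∀ (χ : DirichletCharacter ℂ q), ∀ n ∈ Icc 1 (q - 1),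
      starRingEnd ℂ (χ (n : ZMod q)) = χ ((n : ZMod q)⁻¹) := by
    intro χ n hn
    rw [← RCLike.star_def, MulChar.star_apply', MulChar.inv_apply_eq_inv', ]
    rw [← MulChar.inv_apply_eq_inv', MulChar.inv_apply]
    congr 1
    obtain ⟨u, hu⟩ := hunit n hn
    rw [← hu, Ring.inverse_unit, ZMod.inv_coe_unit]
  have hinj : ∀ m ∈ Icc 1 (q - 1), ∀ n ∈ Icc 1 (q - 1), (m : ZMod q) = n ↔ m = n := by
    intro m hm n hn
    rw [mem_Icc] at hm hn
    rw [ZMod.natCast_eq_natCast_iff', Nat.mod_eq_of_lt (by omega), Nat.mod_eq_of_lt (by omega)]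
  have hc : ((∑ χ : DirichletCharacter ℂ q,
      ‖∑ n ∈ Icc 1 (q - 1), c n * χ (n : ZMod q)‖ ^ 2 : ℝ) : ℂ) =
      ((q.totient * ∑ n ∈ Icc 1 (q - 1), ‖c n‖ ^ 2 : ℝ) : ℂ) := by
    push_cast
    simp_rw [← Complex.conj_mul', map_sum, Finset.sum_mul_sum]
    rw [Finset.sum_comm, Finset.mul_sum]
    refine Finset.sum_congr rfl fun m hm => ?_
    rw [Finset.sum_comm]
    calc ∑ n ∈ Icc 1 (q - 1), ∑ χ : DirichletCharacter ℂ q,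
          starRingEnd ℂ (c m * χ (m : ZMod q)) * (c n * χ (n : ZMod q))
        = ∑ n ∈ Icc 1 (q - 1), starRingEnd ℂ (c m) * c n *
            ∑ χ : DirichletCharacter ℂ q, χ ((m : ZMod q)⁻¹) * χ (n : ZMod q) := by
          refine Finset.sum_congr rfl fun n _ => ?_
          rw [Finset.mul_sum]
          refine Finset.sum_congr rfl fun χ _ => ?_
          rw [map_mul, hstar χ m hm]; ring
      _ = ∑ n ∈ Icc 1 (q - 1),
            starRingEnd ℂ (c m) * c n * if m = n then (q.totient : ℂ) else 0 := by
          refine Finset.sum_congr rfl fun n hn => ?_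
          rw [DirichletCharacter.sum_char_inv_mul_char_eq ℂ (hunit m hm)]
          simp only [hinj m hm n hn]
      _ = _ := by
          simp only [mul_ite, mul_zero, Finset.sum_ite_eq, hm, if_true]
          ring
  exact_mod_cast hc

/-- Second moment of a product of two Dirichlet polynomials with divisor-bounded coefficients and
total length `< q`. -/
lemma sum_norm_sq_mul_le {q : ℕ} [NeZero q] (hq : q.Prime) {Q X : ℕ} (hQX : Q * X < q)
    {α β : ℕ → ℂ} {K : ℝ} (hK : 0 ≤ K) (hα : ∀ n ∈ Icc 1 Q, ‖α n‖ ≤ K / √n)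
    (hβ : ∀ n ∈ Icc 1 X, ‖β n‖ ≤ divTwo n / √n) :
    ∑ χ : DirichletCharacter ℂ q, ‖(∑ n ∈ Icc 1 Q, α n * χ (n : ZMod q)) *
        ∑ n ∈ Icc 1 X, β n * χ (n : ZMod q)‖ ^ 2 ≤
      q.totient * (K ^ 2 * (1 + Real.log q) ^ 9) := by
  classical
  let c : ℕ → ℂ := fun n => ∑ p ∈ n.divisorsAntidiagonal,
    if p.1 ≤ Q ∧ p.2 ≤ X then α p.1 * β p.2 else 0
  have hprod : ∀ χ : DirichletCharacter ℂ q, (∑ n ∈ Icc 1 Q, α n * χ (n : ZMod q)) *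
        ∑ n ∈ Icc 1 X, β n * χ (n : ZMod q) = ∑ n ∈ Icc 1 (q - 1), c n * χ (n : ZMod q) := by
    intro χ
    simp_rw [c, Finset.sum_mul, Finset.mul_sum]
    rw [← Finset.sum_product', Finset.sum_sigma']
    symm
    refine Finset.sum_bij_ne_zero (fun x _ _ => x.2) ?_ ?_ ?_ ?_
    · rintro ⟨n, p⟩ hx h0
      obtain ⟨h1, h2⟩ := Finset.mem_sigma.1 hx
      obtain ⟨h3, h4⟩ := Nat.mem_divisorsAntidiagonal.1 h2
      have h5 : p.1 ≤ Q ∧ p.2 ≤ X := by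
        by_contra h
        simp [h] at h0
      have ha : p.1 ≠ 0 := by rintro h; simp [h] at h3; exact h4 h3.symm
      have hb : p.2 ≠ 0 := by rintro h; simp [h] at h3; exact h4 h3.symm
      simp only [Finset.mem_product, mem_Icc]
      omega
    · rintro ⟨n, p⟩ hx _ ⟨n', p'⟩ hy _ (rfl : p = p')
      have h1 := (Nat.mem_divisorsAntidiagonal.1 (Finset.mem_sigma.1 hx).2).1
      have h2 := (Nat.mem_divisorsAntidiagonal.1 (Finset.mem_sigma.1 hy).2).1
      simp only at h1 h2
      rw [← h1, ← h2]
    · rintro ⟨a, b⟩ hp h0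
      simp only [Finset.mem_product, mem_Icc] at hp
      have hab : 0 < a * b := Nat.mul_pos (by omega) (by omega)
      have hlt : a * b < q := (Nat.mul_le_mul hp.1.2 hp.2.2).trans_lt hQX
      refine ⟨⟨a * b, (a, b)⟩, ?_, ?_, rfl⟩
      · simp only [Finset.mem_sigma, mem_Icc, Nat.mem_divisorsAntidiagonal]
        exact ⟨by omega, trivial, hab.ne'⟩
      · simp only [hp, and_self, if_true]
        convert h0 using 1
        push_cast
        rw [map_mul]; ring
    · rintro ⟨n, p⟩ hx h0
      have h5 : p.1 ≤ Q ∧ p.2 ≤ X := by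
        by_contra h
        simp [h] at h0
      have h1 := (Nat.mem_divisorsAntidiagonal.1 (Finset.mem_sigma.1 hx).2).1
      simp only at h1
      simp only [h5, and_self, if_true]
      rw [← h1]
      push_cast
      rw [map_mul]; ring
  have hc : ∀ n ∈ Icc 1 (q - 1), ‖c n‖ ≤ K * divThree n / √n := by
    intro n hn
    calc ‖c n‖ ≤ ∑ p ∈ n.divisorsAntidiagonal, K * divTwo p.2 / √n := by
          refine norm_sum_le_of_le _ fun p hp => ?_
          obtain ⟨h3, h4⟩ := Nat.mem_divisorsAntidiagonal.1 hp
          have ha : p.1 ≠ 0 := by rintro h; simp [h] at h3; omega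
          have hb : p.2 ≠ 0 := by rintro h; simp [h] at h3; omega
          have hd := divTwo_nonneg p.2
          split_ifs with h
          · rw [norm_mul, ← h3]
            push_cast
            rw [Real.sqrt_mul (Nat.cast_nonneg _), mul_div_mul_comm]
            exact mul_le_mul (hα _ (mem_Icc.2 (by omega))) (hβ _ (mem_Icc.2 (by omega)))
              (norm_nonneg _) (by positivity)
          · rw [norm_zero]; positivity
      _ = K * divThree n / √n := by
          rw [divThree, dirConv, Finset.mul_sum, Finset.sum_div]
          simp
  simp_rw [hprod]
  rw [sum_norm_sq_dirichletPolynomial hq]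
  gcongr
  calc ∑ n ∈ Icc 1 (q - 1), ‖c n‖ ^ 2 ≤ ∑ n ∈ Icc 1 (q - 1), K ^ 2 * (divThree n ^ 2 / n) := by
        refine Finset.sum_le_sum fun n hn => ?_
        calc ‖c n‖ ^ 2 ≤ (K * divThree n / √n) ^ 2 := by gcongr; exact hc n hn
          _ = _ := by rw [div_pow, mul_pow, Real.sq_sqrt (Nat.cast_nonneg _)]; ring
    _ = K ^ 2 * ∑ n ∈ Icc 1 (q - 1), divThree n ^ 2 / n := by rw [Finset.mul_sum]
    _ ≤ K ^ 2 * (1 + Real.log q) ^ 9 := by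
        gcongr
        refine (sum_divThree_sq_div_le _).trans ?_
        have : 0 ≤ ∑ n ∈ Icc 1 (q - 1), (1 : ℝ) / n := Finset.sum_nonneg fun _ _ => by positivity
        gcongr
        refine (sum_one_div_le_one_add_log _).trans ?_
        have h1 : 0 < q - 1 := by have := hq.two_le; omega
        have : ((q - 1 : ℕ) : ℝ) ≤ q := by exact_mod_cast Nat.sub_le _ _
        gcongr

lemma prodChar_apply_natCast {q D : ℕ} (χ : DirichletCharacter ℂ q)
    (ψ : DirichletCharacter ℂ D) (n : ℕ) :
    prodChar χ ψ (n : ZMod (q * D)) = χ (n : ZMod q) * ψ (n : ZMod D) := by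
  by_cases hn : IsUnit (n : ZMod (q * D))
  · have h := (ZMod.isUnit_iff_coprime n (q * D)).1 hn
    obtain ⟨u, hu⟩ := hn
    rw [prodChar, MulChar.mul_apply, ← hu, changeLevel_eq_cast_of_dvd, changeLevel_eq_cast_of_dvd,
      hu, ZMod.cast_natCast (dvd_mul_right q D), ZMod.cast_natCast (dvd_mul_left D q)]
  · rw [MulChar.map_nonunit _ hn]
    rw [ZMod.isUnit_iff_coprime, Nat.coprime_mul_iff_right, not_and_or, ← ZMod.isUnit_iff_coprime,
      ← ZMod.isUnit_iff_coprime] at hn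
    rcases hn with hn | hn <;> simp [MulChar.map_nonunit _ hn]

lemma isPrimitive_of_prime {q : ℕ} (hq : q.Prime) {χ : DirichletCharacter ℂ q} (hχ : χ ≠ 1) :
    χ.IsPrimitive := by
  have : NeZero q := ⟨hq.ne_zero⟩
  refine ((Nat.dvd_prime hq).1 χ.conductor_dvd_level).resolve_left fun h => hχ ?_
  exact eq_one_iff_conductor_eq_one.2 h

/-- The product of primitive characters of coprime moduli is primitive. -/
lemma prodChar_isPrimitive {q D : ℕ} [NeZero q] [NeZero D] (hqD : q.Coprime D)
    {χ : DirichletCharacter ℂ q} {ψ : DirichletCharacter ℂ D} (hχ : χ.IsPrimitive)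
    (hψ : ψ.IsPrimitive) : (prodChar χ ψ).IsPrimitive := by
  set a := changeLevel (dvd_mul_right q D) χ
  set b := changeLevel (dvd_mul_left D q) ψ
  have ha : a.conductor = q := (conductor_changeLevel χ _).trans hχ
  have hb : b.conductor = D := (conductor_changeLevel ψ _).trans hψ
  have hq : q ∣ (a * b).conductor := by
    have h := conductor_mul_dvd_lcm_conductor (a * b) b⁻¹
    rw [mul_inv_cancel_right, conductor_inv, ha, hb] at h
    exact hqD.dvd_of_dvd_mul_right (h.trans (Nat.lcm_dvd_mul _ _))
  have hD : D ∣ (a * b).conductor := by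
    have h := conductor_mul_dvd_lcm_conductor (a * b) a⁻¹
    rw [mul_comm a b, mul_inv_cancel_right, conductor_inv, ha, hb, mul_comm b a] at h
    exact hqD.symm.dvd_of_dvd_mul_right (h.trans (Nat.lcm_dvd_mul _ _))
  exact Nat.dvd_antisymm (conductor_dvd_level _) (hqD.mul_dvd_of_dvd_of_dvd hq hD)

lemma norm_neg_one_apply {N : ℕ} (χ : DirichletCharacter ℂ N) : ‖χ (-1)‖ = 1 := by
  simpa using χ.unit_norm_eq_one (-1)

/-- The absolute value of the Gauss sum of a primitive character. -/
lemma norm_gaussSum_of_isPrimitive {N : ℕ} [NeZero N] {χ : DirichletCharacter ℂ N}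
    (hχ : χ.IsPrimitive) : ‖gaussSum χ ZMod.stdAddChar‖ = √N := by
  have hχ' : χ⁻¹.IsPrimitive := (conductor_inv χ).trans hχ
  have h1 : ‖gaussSum χ⁻¹ (ZMod.stdAddChar (N := N))‖ = ‖gaussSum χ ZMod.stdAddChar‖ := by
    have h := gaussSum_mulShift χ⁻¹ (ZMod.stdAddChar (N := N)) (-1)
    rw [← norm_star (gaussSum χ _), star_gaussSum_eq, ← h, norm_mul, Units.val_neg, Units.val_one,
      norm_neg_one_apply, one_mul, AddChar.inv_mulShift]
  have h2 := congrFun (ZMod.dft_dft (χ : ZMod N → ℂ)) 1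
  have h3 : ZMod.dft (χ : ZMod N → ℂ) =
      fun k => gaussSum χ ZMod.stdAddChar * χ⁻¹ (-k) := by
    funext k
    rw [hχ.fourierTransform_eq_inv_mul_gaussSum, mul_comm]
  have h4 := congrFun (ZMod.dft_comp_neg (fun k => χ⁻¹ k)) 1
  rw [h3, ZMod.dft_const_mul] at h2
  simp only [] at h2 h4
  rw [h4, hχ'.fourierTransform_eq_inv_mul_gaussSum] at h2
  have h5 := congrArg norm h2
  rw [norm_mul, norm_mul, h1, norm_smul, norm_neg_one_apply, neg_neg, map_one, norm_one, one_mul,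
    mul_one, Complex.norm_natCast] at h5
  rw [← h5, Real.sqrt_mul_self (norm_nonneg _)]

open HurwitzZeta

/-- Splitting a sum over the integers twisted by a function modulo `N` into residue classes. -/
lemma hasSum_int_twist {N : ℕ} [NeZero N] (χ : ZMod N → ℂ) (hχ : ∀ j, ‖χ j‖ ≤ 1) {g : ℝ → ℝ}
    {G : UnitAddCircle → ℝ} (hG : ∀ a : ℝ, HasSum (fun n : ℤ => g (n + a)) (G a))
    (hg : Summable fun m : ℤ => g (m / N)) :
    HasSum (fun m : ℤ => χ m * g (m / N)) (∑ j, χ j * G (ZMod.toAddCircle j)) := by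
  have hN : (N : ℝ) ≠ 0 := Nat.cast_ne_zero.2 (NeZero.ne N)
  have hs : Summable fun m : ℤ => χ m * g (m / N) := by
    refine Summable.of_norm_bounded hg.norm fun m => ?_
    rw [norm_mul, Complex.norm_real]
    exact mul_le_of_le_one_left (norm_nonneg _) (hχ _)
  let e : ℤ ≃ ZMod N × ℤ := ((Int.divModEquiv N).trans (Equiv.prodComm _ _)).trans
    ((ZMod.finEquiv N).toEquiv.prodCongr (Equiv.refl ℤ))
  have he (j : ZMod N) (n : ℤ) : e.symm (j, n) = n * N + j.val := by
    obtain ⟨N, rfl⟩ := Nat.exists_eq_succ_of_ne_zero (NeZero.ne N)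
    rfl
  have h1 := e.symm.hasSum_iff.2 hs.hasSum
  have h2 := h1.prod_fiberwise (g := fun j => χ j * G (ZMod.toAddCircle j)) fun j => ?_
  · rw [← h2.unique (hasSum_fintype _)]
    exact hs.hasSum
  · rw [ZMod.toAddCircle_apply]
    refine ((Complex.hasSum_ofReal.2 (hG (j.val / N))).mul_left (χ j)).congr_fun fun n => ?_
    simp only [Function.comp_apply, he]
    push_cast
    rw [ZMod.natCast_zmod_val, CharP.cast_eq_zero, mul_zero, zero_add, add_div,
      mul_div_cancel_right₀ _ hN]

lemma hasSum_int_evenKernel_twist {N : ℕ} [NeZero N] (χ : DirichletCharacter ℂ N) {x : ℝ}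
    (hx : 0 < x) :
    HasSum (fun m : ℤ => χ m * (Real.exp (-Real.pi * (m / N) ^ 2 * x) : ℝ))
      (∑ j, χ j * evenKernel (ZMod.toAddCircle j) x) := by
  have hN : 0 < (N : ℝ) := Nat.cast_pos.2 (NeZero.pos N)
  refine hasSum_int_twist χ χ.norm_le_one (g := fun u => Real.exp (-Real.pi * u ^ 2 * x))
    (G := fun a => evenKernel a x) (fun a => hasSum_int_evenKernel a hx) ?_
  refine (hasSum_int_evenKernel 0 (t := x / N ^ 2) (by positivity)).summable.congr fun m => ?_
  congr 1
  field_simp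
  ring

lemma hasSum_int_oddKernel_twist {N : ℕ} [NeZero N] (χ : DirichletCharacter ℂ N) {x : ℝ}
    (hx : 0 < x) :
    HasSum (fun m : ℤ => χ m * ((m / N) * Real.exp (-Real.pi * (m / N) ^ 2 * x) : ℝ))
      (∑ j, χ j * oddKernel (ZMod.toAddCircle j) x) := by
  have hN : 0 < (N : ℝ) := Nat.cast_pos.2 (NeZero.pos N)
  refine hasSum_int_twist χ χ.norm_le_one (g := fun u => u * Real.exp (-Real.pi * u ^ 2 * x))
    (G := fun a => oddKernel a x) (fun a => hasSum_int_oddKernel a hx) ?_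
  refine ((hasSum_int_oddKernel 0 (x := x / N ^ 2) (by positivity)).summable.div_const
    (N : ℝ)).congr fun m => ?_
  rw [add_zero, mul_div_right_comm]
  congr 2
  field_simp

/-- The additive twist of a primitive character, in terms of its Gauss sum. -/
lemma sum_mul_exp_eq {N : ℕ} [NeZero N] {χ : DirichletCharacter ℂ N} (hχ : χ.IsPrimitive)
    (n : ℤ) :
    ∑ j : ZMod N, χ j * cexp (2 * Real.pi * I * (j.val / N : ℝ) * n) =
      gaussSum χ ZMod.stdAddChar * star (χ n) := by
  have h := gaussSum_mulShift_of_isPrimitive ZMod.stdAddChar hχ n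
  rw [← MulChar.star_apply', mul_comm] at h
  rw [← h, gaussSum]
  refine Finset.sum_congr rfl fun j _ => ?_
  have hj : (n : ZMod N) * j = ((n * j.val : ℤ) : ZMod N) := by
    push_cast
    rw [ZMod.natCast_zmod_val]
  rw [AddChar.mulShift_apply, hj, ZMod.stdAddChar_coe]
  congr 2
  push_cast
  ring

lemma evenKernel_twist_functional_equation {N : ℕ} [NeZero N] {χ : DirichletCharacter ℂ N}
    (hχ : χ.IsPrimitive) {y : ℝ} (hy : 0 < y) :
    ∑ j, χ j * evenKernel (ZMod.toAddCircle j) (N ^ 2 / y) =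
      gaussSum χ ZMod.stdAddChar * (1 / (N ^ 2 / y) ^ (1 / 2 : ℝ) : ℝ) *
        star (∑ j, χ j * evenKernel (ZMod.toAddCircle j) y) := by
  have hN : 0 < (N : ℝ) := Nat.cast_pos.2 (NeZero.pos N)
  have hcos : HasSum (fun n : ℤ => gaussSum χ ZMod.stdAddChar *
      star (χ n * (Real.exp (-Real.pi * (n / N) ^ 2 * y) : ℝ)))
      (∑ j, χ j * cosKernel (ZMod.toAddCircle j) (y / N ^ 2)) := by
    have h := hasSum_sum (s := univ) fun (j : ZMod N) _ =>
      (hasSum_int_cosKernel (j.val / N) (t := y / N ^ 2) (by positivity)).mul_left (χ j)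
    simp only [← ZMod.toAddCircle_apply] at h
    refine h.congr_fun fun n => ?_
    simp only [← mul_assoc, ← Finset.sum_mul, sum_mul_exp_eq hχ]
    simp only [star_mul', Complex.star_def, conj_ofReal, mul_assoc]
    congr 4
    field_simp
  rw [mul_right_comm, ← hcos.unique ((hasSum_int_evenKernel_twist χ hy).star.mul_left _),
    Finset.sum_mul]
  refine Finset.sum_congr rfl fun j _ => ?_
  rw [evenKernel_functional_equation, one_div_div]
  push_cast
  ring

lemma oddKernel_twist_functional_equation {N : ℕ} [NeZero N] {χ : DirichletCharacter ℂ N}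
    (hχ : χ.IsPrimitive) {y : ℝ} (hy : 0 < y) :
    ∑ j, χ j * oddKernel (ZMod.toAddCircle j) (N ^ 2 / y) =
      -I * gaussSum χ ZMod.stdAddChar * (N * (1 / (N ^ 2 / y) ^ (3 / 2 : ℝ)) : ℝ) *
        star (∑ j, χ j * oddKernel (ZMod.toAddCircle j) y) := by
  have hN : 0 < (N : ℝ) := Nat.cast_pos.2 (NeZero.pos N)
  have hsin : HasSum (fun n : ℤ => -I * gaussSum χ ZMod.stdAddChar * N *
      star (χ n * ((n / N) * Real.exp (-Real.pi * (n / N) ^ 2 * y) : ℝ)))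
      (∑ j, χ j * sinKernel (ZMod.toAddCircle j) (y / N ^ 2)) := by
    have h := hasSum_sum (s := univ) fun (j : ZMod N) _ =>
      (hasSum_int_sinKernel (j.val / N) (t := y / N ^ 2) (by positivity)).mul_left (χ j)
    simp only [← ZMod.toAddCircle_apply] at h
    refine h.congr_fun fun n => ?_
    have h1 (j : ZMod N) : χ j * (-I * n * cexp (2 * Real.pi * I * (j.val / N : ℝ) * n) *
        (Real.exp (-Real.pi * n ^ 2 * (y / N ^ 2)) : ℝ)) =
        χ j * cexp (2 * Real.pi * I * (j.val / N : ℝ) * n) *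
          (-I * n * (Real.exp (-Real.pi * n ^ 2 * (y / N ^ 2)) : ℝ)) := by ring
    have h2 : Real.pi * (n / N) ^ 2 * y = Real.pi * n ^ 2 * (y / N ^ 2) := by field_simp
    have hN' : (N : ℂ) ≠ 0 := Nat.cast_ne_zero.2 (NeZero.ne N)
    simp only [h1, ← Finset.sum_mul, sum_mul_exp_eq hχ]
    simp only [star_mul', Complex.star_def, conj_ofReal, neg_mul, h2]
    push_cast
    field_simp
  have h3 : (N * (1 / (N ^ 2 / y) ^ (3 / 2 : ℝ)) : ℝ) =
      (N : ℂ) * (1 / (N ^ 2 / y) ^ (3 / 2 : ℝ) : ℝ) := by push_cast; rfl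
  rw [h3, ← mul_assoc, mul_right_comm,
    ← hsin.unique ((hasSum_int_oddKernel_twist χ hy).star.mul_left _), Finset.sum_mul]
  refine Finset.sum_congr rfl fun j _ => ?_
  rw [oddKernel_functional_equation, one_div_div]
  push_cast
  ring

/-- An even or odd function on the integers sums to twice its sum over the naturals. -/
lemma hasSum_nat_of_hasSum_int {f : ℤ → ℂ} {a : ℂ} (hf : HasSum f a) (h0 : f 0 = 0)
    (h : ∀ n, f (-n) = f n) : HasSum (fun n : ℕ => 2 * f n) a := by
  have := hf.nat_add_neg
  rw [h0, add_zero] at this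
  exact this.congr_fun fun n => by rw [h, two_mul]

open MeasureTheory in
/-- A linear combination of weak FE-pairs whose constant terms cancel is the Mellin transform of
the corresponding linear combination of functions. -/
lemma hasMellin_sum_weakFEPair {ι : Type*} [Fintype ι] (c : ι → ℂ) (P : ι → WeakFEPair ℂ)
    {k : ℝ} {ε : ℂ} (hk : ∀ j, (P j).k = k) (hε : ∀ j, (P j).ε = ε)
    (hf : ∑ j, c j * (P j).f₀ = 0) (hg : ∑ j, c j * (P j).g₀ = 0) (s : ℂ) :
    HasMellin (fun x => ∑ j, c j * (P j).f x) s (∑ j, c j * (P j).Λ s) := by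
  have h1 (j) : HasMellin (P j).f_modif s ((P j).Λ₀ s) :=
    ⟨((P j).isStrongFEPair_toStrongFEPair.hasMellin s).1, rfl⟩
  have h2 : HasMellin (fun x => ∑ j, c j * (P j).f_modif x) s (∑ j, c j * (P j).Λ₀ s) := by
    have hi (j) (_ : j ∈ univ) : IntegrableOn
        (fun x : ℝ => (x : ℂ) ^ (s - 1) * (c j * (P j).f_modif x)) (Set.Ioi 0) := by
      refine Integrable.congr ((h1 j).1.const_mul (c j)) (.of_forall fun x => ?_)
      simp only [smul_eq_mul]
      ring
    refine ⟨?_, ?_⟩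
    · refine (integrable_finsetSum univ hi).congr (.of_forall fun x => ?_)
      simp [Finset.mul_sum]
    · simp only [mellin, smul_eq_mul, Finset.mul_sum]
      rw [integral_finsetSum univ hi]
      refine Finset.sum_congr rfl fun j _ => ?_
      rw [← (h1 j).2, mellin, ← integral_const_mul]
      refine integral_congr_ae (.of_forall fun x => ?_)
      simp only [smul_eq_mul]
      ring
  have h3 : ∑ j, c j * (P j).Λ₀ s = ∑ j, c j * (P j).Λ s := by
    have hj (j) : c j * (P j).Λ₀ s =
        c j * (P j).Λ s + 1 / s * (c j * (P j).f₀) + ε / (k - s) * (c j * (P j).g₀) := by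
      rw [WeakFEPair.Λ₀_eq, hk, hε, smul_eq_mul, smul_eq_mul]
      ring
    simp only [hj, Finset.sum_add_distrib, ← Finset.mul_sum, hf, hg, mul_zero, add_zero]
  have h4 : (fun x : ℝ => (x : ℂ) ^ (s - 1) • ∑ j, c j * (P j).f_modif x)
      =ᵐ[volume.restrict (Set.Ioi 0)] fun x : ℝ => (x : ℂ) ^ (s - 1) • ∑ j, c j * (P j).f x := by
    have h1 : ∀ᵐ x : ℝ ∂volume.restrict (Set.Ioi 0), x ≠ 1 :=
      ae_restrict_of_ae (Measure.ae_ne volume 1)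
    filter_upwards [h1, ae_restrict_mem measurableSet_Ioi] with x hx1 hx0
    congr 1
    rcases lt_or_gt_of_ne hx1 with h | h
    · have hj (j) : c j * (P j).f_modif x =
          c j * (P j).f x - ε * ↑(x ^ (-k)) * (c j * (P j).g₀) := by
        rw [WeakFEPair.f_modif, Pi.add_apply, Set.indicator_of_notMem (Set.notMem_Ioi.2 h.le),
          Set.indicator_of_mem (Set.mem_Ioo.2 ⟨hx0, h⟩), hk, hε, smul_eq_mul]
        ring
      simp only [hj, Finset.sum_sub_distrib, ← Finset.mul_sum, hg, mul_zero, sub_zero]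
    · have hj (j) : c j * (P j).f_modif x = c j * (P j).f x - c j * (P j).f₀ := by
        rw [WeakFEPair.f_modif, Pi.add_apply, Set.indicator_of_mem (Set.mem_Ioi.2 h),
          Set.indicator_of_notMem (Set.notMem_Ioo_of_ge h.le)]
        ring
      simp only [hj, Finset.sum_sub_distrib, hf, sub_zero]
  rw [← h3]
  exact ⟨h2.1.congr h4, (integral_congr_ae h4).symm.trans h2.2⟩

open MeasureTheory in
/-- The Mellin transform at the central point of a function with a functional equation
`x ↔ N ^ 2 / x` is controlled by its part beyond `N`. -/
lemma norm_mellin_le_of_functional_equation {F : ℝ → ℂ} {s N : ℝ} (hN : 0 < N) {w : ℂ}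
    (hw : ‖w‖ = 1) (hF : MellinConvergent F s)
    (hfe : ∀ y, 0 < y → F (N ^ 2 / y) = w * ((y / N) ^ (2 * s) : ℝ) * star (F y)) :
    ‖mellin F s‖ ≤ 2 * ‖∫ x in Set.Ioi N, ((x ^ (s - 1) : ℝ) : ℂ) * F x‖ := by
  set A := ∫ x in Set.Ioi N, ((x ^ (s - 1) : ℝ) : ℂ) * F x with hA
  set G := (Set.Iio N).indicator F with hG
  have hpow {x : ℝ} (hx : 0 < x) (r : ℝ) : (x : ℂ) ^ ((r : ℂ) - 1) = ((x ^ (r - 1) : ℝ) : ℂ) := by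
    rw [ofReal_cpow hx.le]; push_cast; rfl
  have h1 : mellin F s = mellin G s + A := by
    have h := integral_inter_add_sdiff (measurableSet_Iio (a := N)) hF
    rw [← setIntegral_indicator measurableSet_Iio] at h
    have hd : Set.Ioi 0 \ Set.Iio N = Set.Ici N := by
      ext x
      simp only [Set.mem_sdiff, Set.mem_Ioi, Set.mem_Iio, not_lt, Set.mem_Ici,
        and_iff_right_iff_imp]
      exact hN.trans_le
    rw [hd, integral_Ici_eq_integral_Ioi] at h
    rw [mellin, ← h, mellin]
    congr 1
    · refine integral_congr_ae (.of_forall fun x => ?_)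
      simp only [hG, Set.indicator_apply]
      split_ifs <;> simp
    · exact setIntegral_congr_fun measurableSet_Ioi fun x hx => by
        simp only [smul_eq_mul, hpow (hN.trans hx)]
  have h2 : mellin (fun t => G (N ^ 2 * t⁻¹)) (-s : ℂ) =
      w * ((N ^ (2 * s))⁻¹ : ℝ) * star A := by
    rw [mellin, hA, ← starRingEnd_apply, ← integral_conj, ← integral_const_mul]
    have hi : ∫ x : ℝ in Set.Ioi 0, (x : ℂ) ^ (-s - 1 : ℂ) • G (N ^ 2 * x⁻¹) =
        ∫ x : ℝ in Set.Ioi 0, (Set.Ioi N).indicator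
          (fun x : ℝ => (x : ℂ) ^ (-s - 1 : ℂ) • F (N ^ 2 / x)) x := by
      refine setIntegral_congr_fun measurableSet_Ioi fun x (hx : 0 < x) => ?_
      have hmem : N ^ 2 * x⁻¹ < N ↔ N < x := by
        rw [← div_eq_mul_inv, div_lt_iff₀ hx, sq, mul_lt_mul_iff_right₀ hN]
      simp only [hG, Set.indicator_apply, Set.mem_Iio, Set.mem_Ioi, hmem, div_eq_mul_inv]
      split_ifs <;> simp
    rw [hi, setIntegral_indicator measurableSet_Ioi,
      Set.inter_eq_right.2 (Set.Ioi_subset_Ioi hN.le)]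
    refine setIntegral_congr_fun measurableSet_Ioi fun x (hx : N < x) => ?_
    have hx0 := hN.trans hx
    have hx1 : (x : ℂ) ^ (-s - 1 : ℂ) = ((x ^ (-s - 1) : ℝ) : ℂ) := by
      simpa using hpow hx0 (-s)
    have hx2 : x ^ (-s - 1) * (x / N) ^ (2 * s) = (N ^ (2 * s))⁻¹ * x ^ (s - 1) := by
      rw [Real.div_rpow hx0.le hN.le, mul_div_assoc', ← Real.rpow_add hx0, div_eq_inv_mul]
      congr 2
      ring
    simp only [hfe x hx0, hx1, smul_eq_mul, map_mul, conj_ofReal, ← Complex.star_def]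
    have hx3 := congrArg ((↑) : ℝ → ℂ) hx2
    rw [ofReal_mul, ofReal_mul] at hx3
    linear_combination (w * star (F x)) * hx3
  have h3 : mellin G s = w * star A := by
    have h := mellin_comp_mul_left G s (pow_pos hN 2)
    have h' := mellin_comp_inv (fun t => G (N ^ 2 * t)) (-s)
    rw [neg_neg, h, h2, smul_eq_mul] at h'
    have hN2 : ((N ^ 2 : ℝ) : ℂ) ^ (-s : ℂ) = ((N ^ (2 * s))⁻¹ : ℝ) := by
      rw [← ofReal_neg, ← ofReal_cpow (by positivity), Real.rpow_neg (by positivity),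
        Real.rpow_mul hN.le, Real.rpow_two]
    rw [hN2, mul_comm w, mul_assoc] at h'
    have hN3 : (((N ^ (2 * s))⁻¹ : ℝ) : ℂ) ≠ 0 :=
      ofReal_ne_zero.2 (inv_ne_zero (Real.rpow_pos_of_pos hN _).ne')
    exact (mul_left_cancel₀ hN3 h').symm
  rw [h1, h3]
  refine (norm_add_le _ _).trans ?_
  rw [norm_mul, hw, norm_star]
  linarith

open MeasureTheory in
lemma integrableOn_rpow_mul_exp {s b N : ℝ} (hs : 0 < s) (hb : 0 < b) (hN : 0 ≤ N) :
    IntegrableOn (fun x : ℝ => x ^ (s - 1) * Real.exp (-(b * x))) (Set.Ioi N) := by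
  refine IntegrableOn.mono_set ?_ (Set.Ioi_subset_Ioi hN)
  have := integrableOn_rpow_mul_exp_neg_mul_rpow (s := s - 1) (p := 1) (b := b) (by linarith)
    (by norm_num) hb
  simpa using this

open MeasureTheory in
/-- An exponentially decaying bound for the incomplete Gamma integral. -/
lemma integral_Ioi_rpow_mul_exp_le {s b N : ℝ} (hs : 0 < s) (hb : 0 < b) (hN : 0 ≤ N) :
    ∫ x in Set.Ioi N, x ^ (s - 1) * Real.exp (-(b * x)) ≤
      Real.exp (-(b / 2 * N)) * ((2 / b) ^ s * Real.Gamma s) := by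
  have hb2 : 0 < b / 2 := by positivity
  calc ∫ x in Set.Ioi N, x ^ (s - 1) * Real.exp (-(b * x))
      ≤ ∫ x in Set.Ioi N, Real.exp (-(b / 2 * N)) * (x ^ (s - 1) * Real.exp (-(b / 2 * x))) := by
        refine setIntegral_mono_on (integrableOn_rpow_mul_exp hs hb hN)
          ((integrableOn_rpow_mul_exp hs hb2 hN).const_mul _) measurableSet_Ioi
          fun x (hx : N < x) => ?_
        rw [mul_left_comm, ← Real.exp_add]
        refine mul_le_mul_of_nonneg_left (Real.exp_le_exp.2 ?_)
          (Real.rpow_nonneg (hN.trans hx.le) _)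
        nlinarith
    _ ≤ _ := by
        rw [integral_const_mul]
        refine mul_le_mul_of_nonneg_left ?_ (Real.exp_pos _).le
        refine (setIntegral_mono_set (integrableOn_rpow_mul_exp hs hb2 le_rfl) ?_
          (Set.Ioi_subset_Ioi hN).eventuallyLE).trans_eq ?_
        · filter_upwards [ae_restrict_mem measurableSet_Ioi] with x hx
          exact mul_nonneg (Real.rpow_nonneg (le_of_lt hx) _) (Real.exp_pos _).le
        · rw [Real.integral_rpow_mul_exp_neg_mul_Ioi hs hb2, one_div_div]

/-- The weight attached to `n` in the approximate functional equation for characters modulo `N`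
of parity `δ`, up to normalisation. -/
noncomputable def afeWeight (δ N n : ℕ) : ℝ :=
  (n / N : ℝ) ^ δ * ∫ x in Set.Ioi (N : ℝ),
    x ^ ((1 / 4 + δ / 2 : ℝ) - 1) * Real.exp (-(Real.pi * (n / N) ^ 2 * x))

lemma afeWeight_nonneg (δ N n : ℕ) : 0 ≤ afeWeight δ N n := by
  refine mul_nonneg (by positivity) (MeasureTheory.setIntegral_nonneg measurableSet_Ioi
    fun x hx => mul_nonneg (Real.rpow_nonneg ?_ _) (Real.exp_pos _).le)
  exact (Nat.cast_nonneg N).trans (le_of_lt hx)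

lemma afeWeight_le_mul_exp (δ : ℕ) {N n : ℕ} (hN : 0 < N) (hn : 0 < n) :
    afeWeight δ N n ≤ Real.Gamma (1 / 4 + δ / 2) * (√N / √n) * Real.exp (-((n : ℝ) ^ 2 / N)) := by
  have hN' : 0 < (N : ℝ) := Nat.cast_pos.2 hN
  have hn' : 0 < (n : ℝ) := Nat.cast_pos.2 hn
  have hs : (0 : ℝ) < 1 / 4 + δ / 2 := by positivity
  have hG := Real.Gamma_pos_of_pos hs
  have hπ := Real.two_le_pi
  have h := integral_Ioi_rpow_mul_exp_le hs (b := Real.pi * (n / N) ^ 2) (by positivity) hN'.le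
  have h1 : (2 / (Real.pi * (n / N : ℝ) ^ 2)) ^ (1 / 4 + δ / 2 : ℝ) ≤
      (N / n : ℝ) ^ δ * (√N / √n) := by
    have hNn : (0 : ℝ) < N / n := by positivity
    calc (2 / (Real.pi * (n / N : ℝ) ^ 2)) ^ (1 / 4 + δ / 2 : ℝ)
        ≤ ((N / n : ℝ) ^ 2) ^ (1 / 4 + δ / 2 : ℝ) := by
          refine Real.rpow_le_rpow (by positivity) ?_ hs.le
          have : 2 / (Real.pi * (n / N : ℝ) ^ 2) = 2 / Real.pi * (N / n : ℝ) ^ 2 := by field_simp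
          rw [this]
          exact mul_le_of_le_one_left (by positivity) ((div_le_one Real.pi_pos).2 hπ)
      _ = (N / n : ℝ) ^ δ * (√N / √n) := by
          rw [← Real.sqrt_div hN'.le, ← Real.rpow_natCast, ← Real.rpow_natCast,
            ← Real.rpow_mul hNn.le, Real.sqrt_eq_rpow, ← Real.rpow_add hNn]
          congr 1
          push_cast
          ring
  have h2 : Real.exp (-(Real.pi * (n / N : ℝ) ^ 2 / 2 * N)) ≤ Real.exp (-((n : ℝ) ^ 2 / N)) := by
    refine Real.exp_le_exp.2 (neg_le_neg ?_)
    have : Real.pi * (n / N : ℝ) ^ 2 / 2 * N = Real.pi / 2 * ((n : ℝ) ^ 2 / N) := by field_simp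
    rw [this]
    exact le_mul_of_one_le_left (by positivity) (by linarith)
  calc afeWeight δ N n ≤ (n / N : ℝ) ^ δ * (Real.exp (-((n : ℝ) ^ 2 / N)) *
        ((N / n : ℝ) ^ δ * (√N / √n) * Real.Gamma (1 / 4 + δ / 2))) := by
        refine mul_le_mul_of_nonneg_left (h.trans ?_) (by positivity)
        gcongr
    _ = _ := by
        have : (n / N : ℝ) ^ δ * (N / n : ℝ) ^ δ = 1 := by
          rw [← mul_pow, div_mul_div_cancel₀ hN'.ne', div_self hn'.ne', one_pow]
        linear_combination (Real.exp (-((n : ℝ) ^ 2 / N)) * (√N / √n) *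
          Real.Gamma (1 / 4 + δ / 2)) * this

lemma afeWeight_le (δ : ℕ) {N n : ℕ} (hN : 0 < N) (hn : 0 < n) :
    afeWeight δ N n ≤ Real.Gamma (1 / 4 + δ / 2) * (√N / √n) := by
  refine (afeWeight_le_mul_exp δ hN hn).trans (mul_le_of_le_one_right ?_ ?_)
  · have := Real.Gamma_pos_of_pos (s := 1 / 4 + δ / 2) (by positivity)
    positivity
  · exact Real.exp_le_one_iff.2 (neg_nonpos.2 (by positivity))

lemma afeWeight_le_div_pow (δ : ℕ) {N n : ℕ} (hN : 0 < N) (hn : 0 < n) :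
    afeWeight δ N n ≤ Real.Gamma (1 / 4 + δ / 2) * √N * (6 * N ^ 3 / n ^ 6) := by
  have hN' : 0 < (N : ℝ) := Nat.cast_pos.2 hN
  have hn' : (1 : ℝ) ≤ n := Nat.one_le_cast.2 hn
  have hG := Real.Gamma_pos_of_pos (s := 1 / 4 + δ / 2) (by positivity)
  have h1 : Real.exp (-((n : ℝ) ^ 2 / N)) ≤ 6 * N ^ 3 / n ^ 6 := by
    have := Real.pow_div_factorial_le_exp ((n : ℝ) ^ 2 / N) (by positivity) 3
    rw [Real.exp_neg, inv_le_comm₀ (Real.exp_pos _) (by positivity)]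
    refine le_trans (le_of_eq ?_) this
    simp [Nat.factorial]
    field_simp
  have h2 : √N / √n ≤ √N := div_le_self (Real.sqrt_nonneg _) (Real.one_le_sqrt.2 hn')
  refine (afeWeight_le_mul_exp δ hN hn).trans ?_
  gcongr

lemma summable_mul_afeWeight (δ : ℕ) {N : ℕ} (hN : 1 < N) (χ : DirichletCharacter ℂ N) :
    Summable fun n : ℕ => ‖χ n‖ * afeWeight δ N n := by
  have hG := Real.Gamma_pos_of_pos (s := 1 / 4 + δ / 2) (by positivity)
  refine Summable.of_nonneg_of_le (fun n => mul_nonneg (norm_nonneg _) (afeWeight_nonneg _ _ _))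
    (fun n => ?_) ((Real.summable_one_div_nat_pow.2 (by norm_num : 1 < 6)).mul_left
      (Real.Gamma (1 / 4 + δ / 2) * √N * (6 * N ^ 3)))
  rcases Nat.eq_zero_or_pos n with rfl | hn
  · have : Fact (1 < N) := ⟨hN⟩
    simp [MulChar.map_zero χ]
  · refine (mul_le_of_le_one_left (afeWeight_nonneg _ _ _) (χ.norm_le_one _)).trans
      ((afeWeight_le_div_pow δ (by lia) hn).trans_eq ?_)
    ring

open MeasureTheory in
/-- Termwise integration of a twisted theta series. -/
lemma integral_Ioi_rpow_mul_theta (δ : ℕ) {N : ℕ} (hN : 1 < N) (χ : DirichletCharacter ℂ N)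
    {F : ℝ → ℂ} (hF : ∀ x, 0 < x → HasSum (fun n : ℕ =>
      2 * (χ n * ((n / N) ^ δ * Real.exp (-Real.pi * (n / N) ^ 2 * x) : ℝ))) (F x)) :
    ∫ x in Set.Ioi (N : ℝ), ((x ^ ((1 / 4 + δ / 2 : ℝ) - 1) : ℝ) : ℂ) * F x =
      2 * ∑' n : ℕ, χ n * afeWeight δ N n := by
  have : Fact (1 < N) := ⟨hN⟩
  have hN' : 0 < (N : ℝ) := Nat.cast_pos.2 (by lia)
  have hs : (0 : ℝ) < 1 / 4 + δ / 2 := by positivity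
  set f : ℕ → ℝ → ℝ := fun n x => (n / N : ℝ) ^ δ *
    (x ^ ((1 / 4 + δ / 2 : ℝ) - 1) * Real.exp (-(Real.pi * (n / N) ^ 2 * x))) with hf
  have hfint (n : ℕ) (hn : 0 < n) : IntegrableOn (f n) (Set.Ioi (N : ℝ)) :=
    (integrableOn_rpow_mul_exp hs (by positivity) hN'.le).const_mul _
  have hf0 (n : ℕ) (x : ℝ) (hx : x ∈ Set.Ioi (N : ℝ)) : 0 ≤ f n x :=
    mul_nonneg (by positivity) (mul_nonneg (Real.rpow_nonneg (hN'.trans hx).le _)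
      (Real.exp_pos _).le)
  have hfw (n : ℕ) : ∫ x in Set.Ioi (N : ℝ), f n x = afeWeight δ N n := integral_const_mul _ _
  have h1 (n : ℕ) : Integrable (fun x => 2 * (χ n * (f n x : ℂ)))
      (volume.restrict (Set.Ioi (N : ℝ))) := by
    rcases Nat.eq_zero_or_pos n with rfl | hn
    · simp [MulChar.map_zero χ]
    · exact ((hfint n hn).ofReal.const_mul _).const_mul _
  have h2 (n : ℕ) : ∫ x in Set.Ioi (N : ℝ), ‖2 * (χ n * (f n x : ℂ))‖ =
      2 * (‖χ n‖ * afeWeight δ N n) := by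
    rw [← hfw, ← integral_const_mul, ← integral_const_mul]
    refine setIntegral_congr_fun measurableSet_Ioi fun x hx => ?_
    simp only [norm_mul, Complex.norm_real, Real.norm_of_nonneg (hf0 n x hx), Complex.norm_ofNat]
  have h3 := hasSum_integral_of_summable_integral_norm h1
    (by simpa only [h2] using (summable_mul_afeWeight δ hN χ).mul_left 2)
  have h4 (n : ℕ) : ∫ x in Set.Ioi (N : ℝ), 2 * (χ n * (f n x : ℂ)) =
      2 * (χ n * (afeWeight δ N n : ℂ)) := by
    rw [integral_const_mul, integral_const_mul, integral_complex_ofReal, hfw]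
  simp only [h4] at h3
  rw [← tsum_mul_left, h3.tsum_eq]
  refine setIntegral_congr_fun measurableSet_Ioi fun x hx => ?_
  rw [← (hF x (hN'.trans hx)).tsum_eq, ← tsum_mul_left]
  refine tsum_congr fun n => ?_
  simp only [hf, neg_mul]
  push_cast
  ring

/-- The Mellin transform at the central point of a self-dual twisted theta series, bounded by its
Dirichlet series with smooth weights. -/
lemma norm_mellin_theta_le (δ : ℕ) {N : ℕ} (hN : 1 < N) (χ : DirichletCharacter ℂ N)
    {F : ℝ → ℂ} {w : ℂ} (hw : ‖w‖ = 1) (hconv : MellinConvergent F (1 / 4 + δ / 2 : ℝ))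
    (hF : ∀ x, 0 < x → HasSum (fun n : ℤ =>
      χ n * ((n / N) ^ δ * Real.exp (-Real.pi * (n / N) ^ 2 * x) : ℝ)) (F x))
    (hχ : ∀ n : ℤ, χ ((-n : ℤ) : ZMod N) = (-1) ^ δ * χ n)
    (hfe : ∀ y : ℝ, 0 < y →
      F (N ^ 2 / y) = w * ((y / N) ^ (2 * (1 / 4 + δ / 2 : ℝ)) : ℝ) * star (F y)) :
    ‖mellin F (1 / 4 + δ / 2 : ℝ)‖ ≤ 4 * ‖∑' n : ℕ, χ n * afeWeight δ N n‖ := by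
  have : Fact (1 < N) := ⟨hN⟩
  have h1 : ∀ x, 0 < x → HasSum (fun n : ℕ =>
      2 * (χ n * ((n / N) ^ δ * Real.exp (-Real.pi * (n / N) ^ 2 * x) : ℝ))) (F x) := by
    intro x hx
    refine (hasSum_nat_of_hasSum_int (hF x hx) ?_ fun n => ?_).congr_fun fun n => ?_
    · simp [MulChar.map_zero χ]
    · have hδ : ((-1 : ℂ)) ^ δ * (-1) ^ δ = 1 := by rw [← mul_pow]; simp
      rw [hχ, Int.cast_neg, neg_div, neg_sq, neg_pow]
      push_cast
      linear_combination (χ n * ((n / N : ℂ) ^ δ * cexp (-Real.pi * (n / N) ^ 2 * x))) * hδ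
    · push_cast; rfl
  refine (norm_mellin_le_of_functional_equation (by positivity) hw hconv hfe).trans_eq ?_
  rw [integral_Ioi_rpow_mul_theta δ hN χ h1, norm_mul, Complex.norm_ofNat]
  ring

lemma pow_mul_one_div_rpow_eq (δ : ℕ) {N y : ℝ} (hN : 0 < N) (hy : 0 < y) :
    N ^ δ * (1 / (N ^ 2 / y) ^ (1 / 2 + δ : ℝ)) =
      (√N)⁻¹ * (y / N) ^ (2 * (1 / 4 + δ / 2 : ℝ)) := by
  have h : (2 * (1 / 4 + δ / 2) : ℝ) = 1 / 2 + δ := by ring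
  rw [h, Real.div_rpow (by positivity) hy.le, Real.div_rpow hy.le hN.le, one_div_div,
    ← Real.rpow_natCast N 2, ← Real.rpow_mul hN.le, ← Real.rpow_natCast N δ, Real.sqrt_eq_rpow,
    mul_div_left_comm, ← Real.rpow_sub hN, ← Real.rpow_neg hN.le, mul_div_left_comm,
    ← Real.rpow_sub hN]
  congr 2
  push_cast
  ring

lemma norm_cpow_mul_half_div_le {N : ℕ} (hN : 0 < N) {A G : ℂ} {S : ℝ} (hA : ‖A‖ ≤ 4 * S) :
    ‖(N : ℂ) ^ (-(1 / 2) : ℂ) * (A / 2) / G‖ ≤ 2 / ‖G‖ / √N * S := by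
  have h1 : ‖(N : ℂ) ^ (-(1 / 2) : ℂ)‖ = (√N)⁻¹ := by
    rw [Complex.norm_natCast_cpow_of_pos hN, Real.sqrt_eq_rpow, ← Real.rpow_neg (by positivity)]
    norm_num
  rw [norm_div, norm_mul, norm_div, h1, Complex.norm_ofNat]
  calc (√N)⁻¹ * (‖A‖ / 2) / ‖G‖ ≤ (√N)⁻¹ * (4 * S / 2) / ‖G‖ := by gcongr
    _ = _ := by ring

lemma norm_gaussSum_mul_inv_sqrt {N : ℕ} [NeZero N] {χ : DirichletCharacter ℂ N}
    (hχ : χ.IsPrimitive) : ‖gaussSum χ ZMod.stdAddChar * ((√N)⁻¹ : ℝ)‖ = 1 := by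
  have hN : 0 < (N : ℝ) := Nat.cast_pos.2 (NeZero.pos N)
  rw [norm_mul, norm_gaussSum_of_isPrimitive hχ, Complex.norm_real, norm_inv,
    Real.norm_of_nonneg (Real.sqrt_nonneg _), mul_inv_cancel₀ (Real.sqrt_pos.2 hN).ne']

/-- The central value of the L-function of an even primitive character, bounded by a smoothed
Dirichlet series of length about the square root of the conductor. -/
lemma DirichletCharacter.Even.norm_LFunction_half_le {N : ℕ} [NeZero N] (hN : 1 < N)
    {χ : DirichletCharacter ℂ N} (hχ : χ.IsPrimitive) (he : χ.Even) :
    ‖LFunction χ (1 / 2)‖ ≤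
      2 / ‖Gammaℝ (1 / 2)‖ / √N * ‖∑' n : ℕ, χ n * afeWeight 0 N n‖ := by
  have : Fact (1 < N) := ⟨hN⟩
  have hN0 : 0 < (N : ℝ) := by positivity
  set F : ℝ → ℂ := fun x => ∑ j, χ j * evenKernel (ZMod.toAddCircle j) x with hFdef
  have hχ1 : χ ≠ 1 := by
    rintro rfl
    have := hχ.symm.trans conductor_one
    lia
  have hmel : HasMellin F (1 / 4 + (0 : ℕ) / 2 : ℝ)
      (∑ j, χ j * (hurwitzEvenFEPair (ZMod.toAddCircle j)).Λ (1 / 4 + (0 : ℕ) / 2 : ℝ)) := by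
    refine hasMellin_sum_weakFEPair χ (fun j => hurwitzEvenFEPair (ZMod.toAddCircle j))
      (fun _ => rfl) (fun _ => rfl) ?_ ?_ _
    · refine Finset.sum_eq_zero fun j _ => ?_
      by_cases hj : j = 0
      · rw [hj, MulChar.map_zero, zero_mul]
      · simp [hurwitzEvenFEPair, hj]
    · simp [hurwitzEvenFEPair, MulChar.sum_eq_zero_of_ne_one hχ1]
  have hmain := norm_mellin_theta_le 0 hN χ (F := F)
    (w := gaussSum χ ZMod.stdAddChar * ((√N)⁻¹ : ℝ)) ?_ hmel.1 ?_ ?_ ?_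
  · rw [hmel.2] at hmain
    have hL : LFunction χ (1 / 2) = (N : ℂ) ^ (-(1 / 2) : ℂ) * ((∑ j, χ j *
        (hurwitzEvenFEPair (ZMod.toAddCircle j)).Λ (1 / 4 + (0 : ℕ) / 2 : ℝ)) / 2) /
          Gammaℝ (1 / 2) := by
      rw [LFunction, ZMod.LFunction_eq_completed_div_gammaFactor_even he.to_fun _
        (.inl (by norm_num)), ZMod.completedLFunction_def_even he.to_fun, Finset.sum_div]
      congr 2
      refine Finset.sum_congr rfl fun j _ => ?_
      rw [completedHurwitzZetaEven, mul_div_assoc]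
      congr 3
      push_cast
      norm_num
    rw [hL]
    exact norm_cpow_mul_half_div_le (NeZero.pos N) hmain
  · exact norm_gaussSum_mul_inv_sqrt hχ
  · intro x hx
    simpa using hasSum_int_evenKernel_twist χ hx
  · intro n
    simpa using he.to_fun n
  · intro y hy
    simp only [hFdef]
    rw [evenKernel_twist_functional_equation hχ hy]
    congr 1
    rw [mul_assoc, ← ofReal_mul]
    congr 2
    simpa using pow_mul_one_div_rpow_eq 0 hN0 hy

/-- The central value of the L-function of an odd primitive character, bounded by a smoothed
Dirichlet series of length about the square root of the conductor. -/
lemma DirichletCharacter.Odd.norm_LFunction_half_le {N : ℕ} [NeZero N] (hN : 1 < N)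
    {χ : DirichletCharacter ℂ N} (hχ : χ.IsPrimitive) (ho : χ.Odd) :
    ‖LFunction χ (1 / 2)‖ ≤
      2 / ‖Gammaℝ (1 / 2 + 1)‖ / √N * ‖∑' n : ℕ, χ n * afeWeight 1 N n‖ := by
  have hN0 : 0 < (N : ℝ) := by positivity
  set F : ℝ → ℂ := fun x => ∑ j, χ j * oddKernel (ZMod.toAddCircle j) x with hFdef
  have hmel : HasMellin F (1 / 4 + (1 : ℕ) / 2 : ℝ)
      (∑ j, χ j * (hurwitzOddFEPair (ZMod.toAddCircle j)).Λ (1 / 4 + (1 : ℕ) / 2 : ℝ)) := by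
    refine hasMellin_sum_weakFEPair χ (fun j => hurwitzOddFEPair (ZMod.toAddCircle j))
      (fun _ => rfl) (fun _ => rfl) ?_ ?_ _ <;> simp [hurwitzOddFEPair]
  have hmain := norm_mellin_theta_le 1 hN χ (F := F)
    (w := -I * (gaussSum χ ZMod.stdAddChar * ((√N)⁻¹ : ℝ))) ?_ hmel.1 ?_ ?_ ?_
  · rw [hmel.2] at hmain
    have hL : LFunction χ (1 / 2) = (N : ℂ) ^ (-(1 / 2) : ℂ) * ((∑ j, χ j *
        (hurwitzOddFEPair (ZMod.toAddCircle j)).Λ (1 / 4 + (1 : ℕ) / 2 : ℝ)) / 2) /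
          Gammaℝ (1 / 2 + 1) := by
      rw [LFunction, ZMod.LFunction_eq_completed_div_gammaFactor_odd ho.to_fun,
        ZMod.completedLFunction_def_odd ho.to_fun, Finset.sum_div]
      congr 2
      refine Finset.sum_congr rfl fun j _ => ?_
      rw [completedHurwitzZetaOdd, mul_div_assoc]
      congr 3
      push_cast
      norm_num
    rw [hL]
    exact norm_cpow_mul_half_div_le (NeZero.pos N) hmain
  · rw [norm_mul, norm_gaussSum_mul_inv_sqrt hχ, norm_neg, Complex.norm_I, one_mul]
  · intro x hx
    simpa using hasSum_int_oddKernel_twist χ hx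
  · intro n
    simpa using ho.to_fun n
  · intro y hy
    have h := pow_mul_one_div_rpow_eq 1 hN0 hy
    rw [pow_one, show (1 / 2 + (1 : ℕ) : ℝ) = 3 / 2 by norm_num] at h
    simp only [hFdef]
    rw [oddKernel_twist_functional_equation hχ hy, h, ofReal_mul]
    ring

lemma norm_mollifierCoeff_le {D : ℕ} (ψ : DirichletCharacter ℂ D) (n : ℕ) :
    ‖mollifierCoeff ψ n‖ ≤ divTwo n := by
  have hμ (m : ℕ) : ‖((ArithmeticFunction.moebius m : ℤ) : ℂ)‖ ≤ 1 := by
    rw [Complex.norm_intCast]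
    exact_mod_cast ArithmeticFunction.abs_moebius_le_one
  rw [divTwo_eq_card, ← nsmul_one, mollifierCoeff]
  refine norm_sum_le_of_le _ (fun d _ => ?_) |>.trans (Finset.sum_const _).le
  rw [norm_mul, norm_mul]
  exact mul_le_one₀ (mul_le_one₀ (hμ _) (norm_nonneg _) (hμ _)) (norm_nonneg _)
    (ψ.norm_le_one _)

/-- The coefficient of `χ n` in the mollifier. -/
noncomputable def mollifierWeight {D : ℕ} (ψ : DirichletCharacter ℂ D) (n : ℕ) : ℂ :=
  if ¬ D ∣ n then mollifierCoeff ψ n / (√n : ℂ) else 0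

lemma mollifier_eq_sum {q D : ℕ} (ψ : DirichletCharacter ℂ D) (X : ℕ)
    (χ : DirichletCharacter ℂ q) :
    mollifier ψ X χ = ∑ n ∈ Icc 1 X, mollifierWeight ψ n * χ (n : ZMod q) := by
  refine Finset.sum_congr rfl fun n _ => ?_
  rw [mollifierWeight]
  split_ifs
  · rw [zero_mul]
  · rw [div_mul_eq_mul_div]

lemma norm_mollifierWeight_le {D : ℕ} (ψ : DirichletCharacter ℂ D) (n : ℕ) :
    ‖mollifierWeight ψ n‖ ≤ divTwo n / √n := by
  have := divTwo_nonneg n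
  rw [mollifierWeight]
  split_ifs
  · rw [norm_zero]
    positivity
  · rw [norm_div, Complex.norm_of_nonneg (Real.sqrt_nonneg _)]
    gcongr
    exact norm_mollifierCoeff_le ψ n

lemma norm_mollifier_le {q D : ℕ} (ψ : DirichletCharacter ℂ D) (X : ℕ)
    (χ : DirichletCharacter ℂ q) : ‖mollifier ψ X χ‖ ≤ (X : ℝ) ^ 2 := by
  rw [mollifier_eq_sum]
  calc ‖∑ n ∈ Icc 1 X, mollifierWeight ψ n * χ (n : ZMod q)‖
      ≤ ∑ n ∈ Icc 1 X, (X : ℝ) := by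
        refine norm_sum_le_of_le _ fun n hn => ?_
        obtain ⟨h1, h2⟩ := Finset.mem_Icc.1 hn
        have hs : 1 ≤ √(n : ℝ) := Real.one_le_sqrt.2 (by exact_mod_cast h1)
        have hd : divTwo n ≤ X := by
          rw [divTwo_eq_card]
          exact_mod_cast (Nat.card_divisors_le_self n).trans h2
        calc ‖mollifierWeight ψ n * χ (n : ZMod q)‖
            ≤ divTwo n / √n * 1 := by
              rw [norm_mul]
              have := divTwo_nonneg n
              gcongr
              exacts [norm_mollifierWeight_le ψ n, χ.norm_le_one _]
          _ ≤ divTwo n := by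
              rw [mul_one]
              exact div_le_self (divTwo_nonneg n) hs
          _ ≤ X := hd
    _ = (X : ℝ) ^ 2 := by
        rw [Finset.sum_const, Nat.card_Icc, Nat.add_sub_cancel, nsmul_eq_mul, sq]

/-- The tail of a series with terms of size `n⁻⁶`. -/
lemma norm_tsum_add_le_div_pow {a : ℕ → ℂ} {B : ℝ}
    (ha : ∀ n, 0 < n → ‖a n‖ ≤ B / (n : ℝ) ^ 6) (Q : ℕ) :
    ‖∑' n : ℕ, a (n + (Q + 1))‖ ≤ 2 * B / ((Q : ℝ) + 1) ^ 4 := by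
  have hB : 0 ≤ B := by simpa using (norm_nonneg _).trans (ha 1 one_pos)
  have hz : HasSum (fun n : ℕ => B / ((Q : ℝ) + 1) ^ 4 * (1 / ((n + 1 : ℕ) : ℝ) ^ 2))
      (B / ((Q : ℝ) + 1) ^ 4 * (Real.pi ^ 2 / 6)) := by
    refine HasSum.mul_left _ ?_
    have h := (hasSum_nat_add_iff' (f := fun n : ℕ => 1 / (n : ℝ) ^ 2) 1).2 hasSum_zeta_two
    simpa using h
  refine (tsum_of_norm_bounded hz fun n => ?_).trans ?_
  · refine (ha _ (by lia)).trans ?_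
    rw [div_mul_div_comm, mul_one]
    push_cast
    have h4 : ((Q : ℝ) + 1) ^ 4 ≤ ((n : ℝ) + (Q + 1)) ^ 4 :=
      pow_le_pow_left₀ (by positivity) (by linarith [(n.cast_nonneg : (0 : ℝ) ≤ n)]) 4
    have h2 : ((n : ℝ) + 1) ^ 2 ≤ ((n : ℝ) + (Q + 1)) ^ 2 :=
      pow_le_pow_left₀ (by positivity) (by linarith [(Q.cast_nonneg : (0 : ℝ) ≤ Q)]) 2
    gcongr
    calc ((Q : ℝ) + 1) ^ 4 * ((n : ℝ) + 1) ^ 2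
        ≤ ((n : ℝ) + (Q + 1)) ^ 4 * ((n : ℝ) + (Q + 1)) ^ 2 := by gcongr
      _ = _ := by ring
  · have hpi : Real.pi ^ 2 / 6 ≤ 2 := by nlinarith [Real.pi_lt_d2, Real.pi_pos]
    calc B / ((Q : ℝ) + 1) ^ 4 * (Real.pi ^ 2 / 6) ≤ B / ((Q : ℝ) + 1) ^ 4 * 2 := by gcongr
      _ = _ := by ring

/-- The mollified second moment of a smoothed Dirichlet series of length about `√(q * D)`. -/
lemma sum_norm_sq_tsum_mul_mollifier_le {q D : ℕ} [NeZero q] (hq : q.Prime) (hD : 1 < D)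
    (hqD : (D : ℝ) ^ 300 ≤ q) (ψ : DirichletCharacter ℂ D) {V : ℕ → ℝ} {K : ℝ}
    (hV : ∀ n, 0 ≤ V n) (hV1 : ∀ n, 0 < n → V n ≤ K / √n)
    (hV2 : ∀ n, 0 < n → V n ≤ K * (6 * ((q : ℝ) * D) ^ 3) / (n : ℝ) ^ 6) :
    ∑ χ : DirichletCharacter ℂ q,
        ‖(∑' n : ℕ, prodChar χ ψ n * V n) * mollifier ψ (D ^ 20) χ‖ ^ 2 ≤
      2 * q.totient * (K ^ 2 * ((1 + Real.log q) ^ 9 + 144)) := by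
  have hK : 0 ≤ K := by simpa using (hV 1).trans (hV1 1 one_pos)
  have hq0 : (0 : ℝ) < q := by exact_mod_cast hq.pos
  have hD1 : (1 : ℝ) ≤ D := by exact_mod_cast hD.le
  set X := D ^ 20 with hX
  have hX0 : 0 < X := by positivity
  set Q := (q - 1) / X with hQ
  have hQX : Q * X < q := (Nat.div_mul_le_self _ _).trans_lt (Nat.sub_one_lt hq.ne_zero)
  have hqQ : (q : ℝ) ≤ ((Q : ℝ) + 1) * (D : ℝ) ^ 20 := by
    have h : q - 1 < X * (Q + 1) := Nat.lt_mul_div_succ _ hX0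
    have h' : q ≤ (Q + 1) * X := by
      rw [mul_comm]
      lia
    exact_mod_cast h'
  have hterm (χ : DirichletCharacter ℂ q) (n : ℕ) : ‖prodChar χ ψ n * V n‖ ≤ V n := by
    rw [norm_mul, Complex.norm_of_nonneg (hV n)]
    exact mul_le_of_le_one_left (hV n) (DirichletCharacter.norm_le_one _ _)
  have htail (χ : DirichletCharacter ℂ q) :
      ‖(∑' n : ℕ, prodChar χ ψ ((n + (Q + 1) : ℕ) : ZMod (q * D)) * V (n + (Q + 1))) *
        mollifier ψ X χ‖ ≤ 12 * K := by
    have h1 := norm_tsum_add_le_div_pow (a := fun n => prodChar χ ψ n * V n)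
      (fun n hn => (hterm χ n).trans (hV2 n hn)) Q
    have h2 : ((q : ℝ) * D) ^ 3 / ((Q : ℝ) + 1) ^ 4 ≤ (D : ℝ) ^ 83 / q := by
      rw [div_le_div_iff₀ (by positivity) hq0]
      calc ((q : ℝ) * D) ^ 3 * q = (D : ℝ) ^ 3 * (q : ℝ) ^ 4 := by ring
        _ ≤ (D : ℝ) ^ 3 * (((Q : ℝ) + 1) * (D : ℝ) ^ 20) ^ 4 := by gcongr
        _ = _ := by ring
    have h3 : (D : ℝ) ^ 123 / q ≤ 1 := by
      rw [div_le_one hq0]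
      exact (pow_le_pow_right₀ hD1 (by norm_num)).trans hqD
    rw [norm_mul]
    calc _ ≤ 2 * (K * (6 * ((q : ℝ) * D) ^ 3)) / ((Q : ℝ) + 1) ^ 4 * (X : ℝ) ^ 2 := by
          gcongr
          exact norm_mollifier_le ψ X χ
      _ = 12 * K * (((q : ℝ) * D) ^ 3 / ((Q : ℝ) + 1) ^ 4) * ((D : ℝ) ^ 20) ^ 2 := by
          rw [hX]
          push_cast
          ring
      _ ≤ 12 * K * ((D : ℝ) ^ 83 / q) * ((D : ℝ) ^ 20) ^ 2 := by gcongr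
      _ = 12 * K * ((D : ℝ) ^ 123 / q) := by ring
      _ ≤ 12 * K := mul_le_of_le_one_right (by positivity) h3
  have hsumm (χ : DirichletCharacter ℂ q) : Summable fun n : ℕ => prodChar χ ψ n * V n := by
    refine Summable.of_norm_bounded_eventually_nat
      (g := fun n : ℕ => K * (6 * ((q : ℝ) * D) ^ 3) * ((n : ℝ) ^ 6)⁻¹)
      ((Real.summable_nat_pow_inv.2 (by norm_num)).mul_left _) ?_
    filter_upwards [Filter.eventually_gt_atTop 0] with n hn
    exact (hterm χ n).trans (hV2 n hn)
  have hsplit (χ : DirichletCharacter ℂ q) : ∑' n : ℕ, prodChar χ ψ n * V n =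
      ∑ n ∈ Icc 1 Q, (ψ n * V n) * χ (n : ZMod q) +
        ∑' n : ℕ, prodChar χ ψ ((n + (Q + 1) : ℕ) : ZMod (q * D)) * V (n + (Q + 1)) := by
    rw [← (hsumm χ).sum_add_tsum_nat_add (Q + 1)]
    congr 1
    have : Fact (1 < q) := ⟨hq.one_lt⟩
    rw [Finset.range_eq_Ico, Finset.sum_eq_sum_Ico_succ_bot (Nat.succ_pos Q),
      prodChar_apply_natCast, Nat.cast_zero, MulChar.map_zero, zero_mul, zero_mul, zero_add]
    refine Finset.sum_congr (by ext; simp) fun n _ => ?_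
    rw [prodChar_apply_natCast]
    ring
  have hhead := sum_norm_sq_mul_le hq hQX hK (α := fun n => ψ n * V n)
    (β := mollifierWeight ψ) (fun n hn => ?_) (fun n _ => norm_mollifierWeight_le ψ n)
  · have hcard : (Finset.univ : Finset (DirichletCharacter ℂ q)).card = q.totient := by
      rw [Finset.card_univ, ← Nat.card_eq_fintype_card,
        DirichletCharacter.card_eq_totient_of_hasEnoughRootsOfUnity ℂ q]
    calc _ ≤ ∑ χ : DirichletCharacter ℂ q, (2 * ‖(∑ n ∈ Icc 1 Q, (ψ n * V n) * χ (n : ZMod q)) *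
            ∑ n ∈ Icc 1 X, mollifierWeight ψ n * χ (n : ZMod q)‖ ^ 2 + 2 * (12 * K) ^ 2) := by
          refine Finset.sum_le_sum fun χ _ => ?_
          rw [hsplit χ, add_mul, ← mollifier_eq_sum]
          refine (pow_le_pow_left₀ (norm_nonneg _) ((norm_add_le _ _).trans
            (add_le_add_right (htail χ) _)) 2).trans ?_
          rw [← mul_add]
          exact add_sq_le
      _ ≤ 2 * (q.totient * (K ^ 2 * (1 + Real.log q) ^ 9)) + q.totient * (2 * (12 * K) ^ 2) := by
          rw [Finset.sum_add_distrib, ← Finset.mul_sum, Finset.sum_const, hcard, nsmul_eq_mul]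
          gcongr
      _ = _ := by ring
  · rw [norm_mul, Complex.norm_of_nonneg (hV n)]
    exact (mul_le_of_le_one_left (hV n) (ψ.norm_le_one _)).trans
      (hV1 n (Finset.mem_Icc.1 hn).1)

/-- The constant in the pointwise bounds for the normalized weight of the approximate functional
equation. -/
noncomputable def afeConst (δ : ℕ) : ℝ :=
  2 / ‖Gammaℝ (1 / 2 + δ)‖ * Real.Gamma (1 / 4 + δ / 2)

lemma sum_norm_sq_afe_mul_mollifier_le {q D : ℕ} [NeZero q] (hq : q.Prime) (hD : 1 < D)
    (hqD : (D : ℝ) ^ 300 ≤ q) (ψ : DirichletCharacter ℂ D) (δ : ℕ) :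
    ∑ χ : DirichletCharacter ℂ q,
        (2 / ‖Gammaℝ (1 / 2 + δ)‖ / √(q * D : ℕ) *
          ‖∑' n : ℕ, prodChar χ ψ n * afeWeight δ (q * D) n‖ * ‖mollifier ψ (D ^ 20) χ‖) ^ 2 ≤
      2 * q.totient * (afeConst δ ^ 2 * ((1 + Real.log q) ^ 9 + 144)) := by
  have hN : 0 < q * D := Nat.mul_pos hq.pos (by lia)
  have hs : 0 < √((q * D : ℕ) : ℝ) := Real.sqrt_pos.2 (by exact_mod_cast hN)
  set κ : ℝ := 2 / ‖Gammaℝ (1 / 2 + δ)‖ / √(q * D : ℕ) with hκ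
  have hκ0 : 0 ≤ κ := by positivity
  have hκs : κ * √(q * D : ℕ) = 2 / ‖Gammaℝ (1 / 2 + δ)‖ := div_mul_cancel₀ _ hs.ne'
  refine le_of_eq_of_le (Finset.sum_congr rfl fun χ _ => ?_)
    (sum_norm_sq_tsum_mul_mollifier_le hq hD hqD ψ (V := fun n => κ * afeWeight δ (q * D) n)
      (fun n => mul_nonneg hκ0 (afeWeight_nonneg _ _ _)) (fun n hn => ?_) (fun n hn => ?_))
  · have h : ∑' n : ℕ, prodChar χ ψ n * ((κ * afeWeight δ (q * D) n : ℝ) : ℂ) =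
        κ * ∑' n : ℕ, prodChar χ ψ n * afeWeight δ (q * D) n := by
      rw [← tsum_mul_left]
      refine tsum_congr fun n => ?_
      push_cast
      ring
    rw [h, norm_mul, norm_mul, Complex.norm_of_nonneg hκ0]
  · calc _ ≤ κ * (Real.Gamma (1 / 4 + δ / 2) * (√(q * D : ℕ) / √n)) := by
          gcongr
          exact afeWeight_le δ hN hn
      _ = κ * √(q * D : ℕ) * Real.Gamma (1 / 4 + δ / 2) / √n := by ring
      _ = _ := by rw [hκs, afeConst]
  · calc _ ≤ κ * (Real.Gamma (1 / 4 + δ / 2) * √(q * D : ℕ) *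
            (6 * ((q * D : ℕ) : ℝ) ^ 3 / (n : ℝ) ^ 6)) := by
          gcongr
          exact afeWeight_le_div_pow δ hN hn
      _ = κ * √(q * D : ℕ) * Real.Gamma (1 / 4 + δ / 2) * (6 * ((q * D : ℕ) : ℝ) ^ 3) /
            (n : ℝ) ^ 6 := by ring
      _ = _ := by rw [hκs, afeConst, Nat.cast_mul]

/-- The central value of a primitive character of either parity. -/
lemma norm_LFunction_half_sq_le {N : ℕ} [NeZero N] (hN : 1 < N) {χ : DirichletCharacter ℂ N}
    (hχ : χ.IsPrimitive) : ‖LFunction χ (1 / 2)‖ ^ 2 ≤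
      ∑ δ ∈ Finset.range 2, (2 / ‖Gammaℝ (1 / 2 + δ)‖ / √N *
        ‖∑' n : ℕ, χ n * afeWeight δ N n‖) ^ 2 := by
  rw [Finset.sum_range_succ, Finset.sum_range_one, Nat.cast_zero, add_zero, Nat.cast_one]
  obtain he | ho := χ.even_or_odd
  · exact (pow_le_pow_left₀ (norm_nonneg _) (he.norm_LFunction_half_le hN hχ) 2).trans
      (le_add_of_nonneg_right (sq_nonneg _))
  · exact (pow_le_pow_left₀ (norm_nonneg _) (ho.norm_LFunction_half_le hN hχ) 2).trans
      (le_add_of_nonneg_left (sq_nonneg _))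

open scoped Classical in
/-- second mollified moment bound
`Σ_{χ mod q, χ ≠ χ₀} |L(1/2, χψ) M(χ)|² ≪ φ(q) (log q)^9`, the implied constant depending
only on `C`. -/
theorem second_moment_mollified_L (C : ℝ) (hC : 300 < C) :
    ∃ c : ℝ, 0 < c ∧
      ∀ (D : ℕ) [NeZero D], 1 < D → Squarefree D → D % 4 = 1 →
      ∀ ψ : DirichletCharacter ℂ D, ψ.IsPrimitive → ψ ^ 2 = 1 → ψ ≠ 1 →
      ∀ (q : ℕ) [NeZero q], q.Prime → ((D : ℝ) ^ (300 : ℕ) ≤ q) → ((q : ℝ) ≤ (D : ℝ) ^ C) →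
      ∑ χ ∈ Finset.univ.filter (fun χ : DirichletCharacter ℂ q => χ ≠ 1),
          ‖LFunction (prodChar χ ψ) (1 / 2) * mollifier ψ (D ^ 20) χ‖ ^ 2 ≤
        c * (Nat.totient q) * Real.log q ^ 9 := by
  refine ⟨1312 * ∑ δ ∈ Finset.range 2, afeConst δ ^ 2 + 1,
    add_pos_of_nonneg_of_pos (mul_nonneg (by norm_num)
      (Finset.sum_nonneg fun _ _ => sq_nonneg _)) one_pos, ?_⟩
  intro D _ hD _ _ ψ hψ _ _ q _ hq hqD _
  have hD2 : (2 : ℝ) ≤ D := by exact_mod_cast hD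
  have hDq : D < q := by
    have h : (D : ℝ) < D ^ 300 := lt_self_pow₀ (by linarith) (by norm_num)
    exact_mod_cast h.trans_le hqD
  have hco : q.Coprime D :=
    (hq.coprime_iff_not_dvd).2 fun h => (Nat.le_of_dvd (by lia) h).not_gt hDq
  have hlog : 1 ≤ Real.log q := by
    rw [Real.le_log_iff_exp_le (by exact_mod_cast hq.pos)]
    have h3 : (2 : ℝ) ^ 2 ≤ D ^ 300 :=
      (pow_le_pow_left₀ (by norm_num) hD2 2).trans
        (pow_le_pow_right₀ (by linarith) (by norm_num))
    linarith [Real.exp_one_lt_d9]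
  calc _ ≤ ∑ χ : DirichletCharacter ℂ q, ∑ δ ∈ Finset.range 2,
          (2 / ‖Gammaℝ (1 / 2 + δ)‖ / √(q * D : ℕ) *
            ‖∑' n : ℕ, prodChar χ ψ n * afeWeight δ (q * D) n‖ *
              ‖mollifier ψ (D ^ 20) χ‖) ^ 2 := by
        refine (Finset.sum_le_sum fun χ hχ => ?_).trans
          (Finset.sum_le_sum_of_subset_of_nonneg (Finset.filter_subset _ _)
            fun _ _ _ => Finset.sum_nonneg fun _ _ => sq_nonneg _)
        have hprim := prodChar_isPrimitive hco
          (isPrimitive_of_prime hq (Finset.mem_filter.1 hχ).2) hψ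
        simp_rw [mul_pow _ ‖mollifier ψ (D ^ 20) χ‖]
        rw [norm_mul, mul_pow, ← Finset.sum_mul]
        gcongr
        exact norm_LFunction_half_sq_le (one_lt_mul_of_lt_of_le hq.one_lt hD.le) hprim
    _ ≤ ∑ δ ∈ Finset.range 2,
          2 * q.totient * (afeConst δ ^ 2 * ((1 + Real.log q) ^ 9 + 144)) := by
        rw [Finset.sum_comm]
        exact Finset.sum_le_sum fun δ _ => sum_norm_sq_afe_mul_mollifier_le hq hD hqD ψ δ
    _ = 2 * (∑ δ ∈ Finset.range 2, afeConst δ ^ 2) * q.totient *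
          ((1 + Real.log q) ^ 9 + 144) := by
        rw [← Finset.mul_sum, ← Finset.sum_mul]
        ring
    _ ≤ 2 * (∑ δ ∈ Finset.range 2, afeConst δ ^ 2) * q.totient * (656 * Real.log q ^ 9) := by
        gcongr
        have h1 : (1 + Real.log q) ^ 9 ≤ (2 * Real.log q) ^ 9 := by
          gcongr
          linarith
        have h2 : 1 ≤ Real.log q ^ 9 := one_le_pow₀ hlog
        rw [mul_pow] at h1
        linarith
    _ ≤ _ := by
        have h : 0 ≤ q.totient * Real.log q ^ 9 := by positivity
        linarith
end

section
/- Let k be a positive integer, let D > 1 be a squarefree fundamental discriminant with associated primitive quadratic character ψ modulo D, and let q be an odd prime with q ∤ D. Then Σ⁺_{χ mod q} (ε(χ)·ε(χψ))^k = (ψ(q)^k·ε(ψ)^k·φ(q)/(2q^k)) · Σ_{ℓ=0}^{1} Σ_{a₁,…,a_{2k−1} mod q, (a_j, q) = 1} e( (a₁ + ⋯ + a_{2k−1} + (−1)^ℓ·inv(D^k·a₁⋯a_{2k−1}) ) / q ) − ψ(q)^k·ε(ψ)^k/q^k, where inv(x) denotes the multiplicative inverse of x modulo q. -/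
open Complex DirichletCharacter Finset

/-- `e(z/q)` for `z : ZMod q`. -/
noncomputable def eZMod (q : ℕ) [NeZero q] (z : ZMod q) : ℂ := eFun ((z.val : ℝ) / q)

/-- `eZMod` is the standard additive character of `ZMod q`. -/
lemma eZMod_eq_stdAddChar (q : ℕ) [NeZero q] (z : ZMod q) : eZMod q z = ZMod.stdAddChar z := by
  rw [eZMod, eFun, ZMod.stdAddChar_apply, ZMod.toCircle_apply]
  push_cast
  congr 1
  ring

lemma epsChar_eq_gaussSum {N : ℕ} [NeZero N] (χ : DirichletCharacter ℂ N) :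
    epsChar χ = (Real.sqrt N : ℂ)⁻¹ * gaussSum χ ZMod.stdAddChar := by
  simp only [epsChar, gaussSum, ← eZMod_eq_stdAddChar, eZMod]

lemma prodChar_natCast {q D : ℕ} (χ : DirichletCharacter ℂ q) (ψ : DirichletCharacter ℂ D)
    (n : ℕ) : prodChar χ ψ (n : ZMod (q * D)) = χ n * ψ n := by
  by_cases h : n.Coprime (q * D)
  · have hn : IsCoprime (n : ℤ) ((q * D : ℕ) : ℤ) := Nat.isCoprime_iff_coprime.2 h
    have h₁ := changeLevel_eq_cast_of_dvd' χ (dvd_mul_right q D) hn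
    have h₂ := changeLevel_eq_cast_of_dvd' ψ (dvd_mul_left D q) hn
    simp only [Int.cast_natCast] at h₁ h₂
    rw [prodChar, MulChar.mul_apply, h₁, h₂]
  · rw [MulChar.map_nonunit _ (fun hu => h ((ZMod.isUnit_iff_coprime _ _).1 hu))]
    rw [Nat.coprime_mul_iff_right, not_and_or] at h
    rcases h with h | h
    · rw [MulChar.map_nonunit χ (fun hu => h ((ZMod.isUnit_iff_coprime _ _).1 hu)), zero_mul]
    · rw [MulChar.map_nonunit ψ (fun hu => h ((ZMod.isUnit_iff_coprime _ _).1 hu)), mul_zero]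

lemma stdAddChar_natCast {N : ℕ} [NeZero N] (n : ℕ) :
    ZMod.stdAddChar (n : ZMod N) = Complex.exp (2 * Real.pi * Complex.I * n / N) := by
  simpa using ZMod.stdAddChar_coe (N := N) (n : ℤ)

/-- For coprime `q` and `D`, the residues `D x + q y` run through `ZMod (q * D)`. -/
lemma bijective_mul_val_add_mul_val {q D : ℕ} [NeZero q] [NeZero D] (h : q.Coprime D) :
    Function.Bijective (fun p : ZMod q × ZMod D =>
      ((D * p.1.val + q * p.2.val : ℕ) : ZMod (q * D))) := by
  rw [Fintype.bijective_iff_injective_and_card]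
  refine ⟨?_, by simp [ZMod.card]⟩
  rintro ⟨x, y⟩ ⟨x', y'⟩ hxy
  simp only at hxy
  have h₁ := congrArg (ZMod.castHom (dvd_mul_right q D) (ZMod q)) hxy
  have h₂ := congrArg (ZMod.castHom (dvd_mul_left D q) (ZMod D)) hxy
  simp only [map_natCast] at h₁ h₂
  push_cast at h₁ h₂
  simp only [ZMod.natCast_val, ZMod.cast_id', id, CharP.cast_eq_zero, zero_mul, add_zero,
    zero_add] at h₁ h₂
  have hD : IsUnit (D : ZMod q) := (ZMod.isUnit_iff_coprime _ _).2 h.symm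
  have hq : IsUnit (q : ZMod D) := (ZMod.isUnit_iff_coprime _ _).2 h
  rw [hD.mul_left_cancel h₁, hq.mul_left_cancel h₂]

lemma gaussSum_prodChar {q D : ℕ} [NeZero q] [NeZero D] (h : q.Coprime D)
    (χ : DirichletCharacter ℂ q) (ψ : DirichletCharacter ℂ D) :
    gaussSum (prodChar χ ψ) ZMod.stdAddChar =
      χ D * ψ q * gaussSum χ ZMod.stdAddChar * gaussSum ψ ZMod.stdAddChar := by
  have hq : (q : ℂ) ≠ 0 := Nat.cast_ne_zero.2 (NeZero.ne q)
  have hD : (D : ℂ) ≠ 0 := Nat.cast_ne_zero.2 (NeZero.ne D)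
  rw [gaussSum, ← (bijective_mul_val_add_mul_val h).sum_comp, mul_assoc, gaussSum, gaussSum,
    Finset.sum_mul_sum, Fintype.sum_prod_type, Finset.mul_sum]
  refine Finset.sum_congr rfl fun x _ => ?_
  rw [Finset.mul_sum]
  refine Finset.sum_congr rfl fun y _ => ?_
  have hx : ZMod.stdAddChar x = Complex.exp (2 * Real.pi * Complex.I * x.val / q) := by
    rw [← stdAddChar_natCast, ZMod.natCast_zmod_val]
  have hy : ZMod.stdAddChar y = Complex.exp (2 * Real.pi * Complex.I * y.val / D) := by
    rw [← stdAddChar_natCast, ZMod.natCast_zmod_val]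
  have he : Complex.exp (2 * Real.pi * Complex.I * ((D * x.val + q * y.val : ℕ) : ℂ) /
      ((q * D : ℕ) : ℂ)) = Complex.exp (2 * Real.pi * Complex.I * x.val / q) *
        Complex.exp (2 * Real.pi * Complex.I * y.val / D) := by
    rw [← Complex.exp_add]
    congr 1
    push_cast
    field_simp
  rw [prodChar_natCast, stdAddChar_natCast, he, hx, hy]
  have h₁ : ((D * x.val + q * y.val : ℕ) : ZMod q) = D * x := by simp
  have h₂ : ((D * x.val + q * y.val : ℕ) : ZMod D) = q * y := by simp
  rw [h₁, h₂, map_mul, map_mul]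
  ring

lemma epsChar_prodChar {q D : ℕ} [NeZero q] [NeZero D] (h : q.Coprime D)
    (χ : DirichletCharacter ℂ q) (ψ : DirichletCharacter ℂ D) :
    epsChar (prodChar χ ψ) = χ D * ψ q * epsChar χ * epsChar ψ := by
  simp only [epsChar_eq_gaussSum, gaussSum_prodChar h, Nat.cast_mul,
    Real.sqrt_mul (Nat.cast_nonneg q), Complex.ofReal_mul, mul_inv]
  ring

lemma epsChar_mul_epsChar_prodChar_pow {q D : ℕ} [NeZero q] [NeZero D] (h : q.Coprime D)
    (χ : DirichletCharacter ℂ q) (ψ : DirichletCharacter ℂ D) (k : ℕ) :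
    (epsChar χ * epsChar (prodChar χ ψ)) ^ k =
      ψ q ^ k * epsChar ψ ^ k / (q : ℂ) ^ k *
        (χ D ^ k * gaussSum χ ZMod.stdAddChar ^ (2 * k)) := by
  have hs : ((Real.sqrt q : ℂ)⁻¹) ^ 2 = (q : ℂ)⁻¹ := by
    rw [inv_pow, ← Complex.ofReal_pow, Real.sq_sqrt (Nat.cast_nonneg q), Complex.ofReal_natCast]
  have : epsChar χ * epsChar (prodChar χ ψ) =
      ψ q * epsChar ψ * (q : ℂ)⁻¹ * (χ D * gaussSum χ ZMod.stdAddChar ^ 2) := by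
    rw [epsChar_prodChar h, ← hs, epsChar_eq_gaussSum χ]
    ring
  rw [this, pow_mul]
  simp only [mul_pow, inv_pow, div_eq_mul_inv]

lemma gaussSum_eq_sum_units {R R' : Type*} [CommRing R] [Fintype R] [DecidableEq R] [CommRing R']
    (χ : MulChar R R') (e : AddChar R R') : gaussSum χ e = ∑ u : Rˣ, χ u * e u := by
  refine (Finset.sum_of_injOn (fun u : Rˣ => (u : R)) Units.val_injective.injOn (by simp) ?_
    (fun _ _ => rfl)).symm
  intro a _ ha
  rw [MulChar.map_nonunit, zero_mul]
  rintro ⟨u, rfl⟩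
  exact ha ⟨u, by simp, rfl⟩

lemma addChar_map_sum_eq_prod {ι A M : Type*} [AddCommMonoid A] [CommMonoid M] (e : AddChar A M)
    (s : Finset ι) (f : ι → A) : e (∑ i ∈ s, f i) = ∏ i ∈ s, e (f i) := by
  classical
  induction s using Finset.induction_on with
  | empty => simp
  | insert i s hi ih => rw [Finset.sum_insert hi, Finset.prod_insert hi, e.map_add_eq_mul, ih]

/-- Expansion of a power of a Gauss sum, with one of the summation variables singled out. -/
lemma gaussSum_pow_succ {R R' : Type*} [CommRing R] [Fintype R] [DecidableEq R] [CommRing R']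
    (χ : MulChar R R') (e : AddChar R R') (m : ℕ) :
    gaussSum χ e ^ (m + 1) = ∑ a : Fin m → Rˣ, ∑ b : Rˣ,
      χ ((∏ j, (a j : R)) * b) * e ((∑ j, (a j : R)) + b) := by
  rw [pow_succ, gaussSum_eq_sum_units, Fintype.sum_pow, Finset.sum_mul_sum]
  refine Finset.sum_congr rfl fun a _ => Finset.sum_congr rfl fun b _ => ?_
  rw [Finset.prod_mul_distrib, map_mul, map_prod, AddChar.map_add_eq_mul, addChar_map_sum_eq_prod]
  ring

/-- Averaging a twisted power of Gauss sums over all characters gives a Kloosterman-type sum. -/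
lemma sum_char_mul_gaussSum_pow {q : ℕ} [NeZero q] (c : (ZMod q)ˣ) (m : ℕ)
    (e : AddChar (ZMod q) ℂ) :
    ∑ χ : DirichletCharacter ℂ q, χ c * gaussSum χ e ^ (m + 1) =
      q.totient * ∑ a : Fin m → (ZMod q)ˣ,
        e ((∑ j, (a j : ZMod q)) + ((c * ∏ j, a j)⁻¹ : (ZMod q)ˣ)) := by
  simp only [gaussSum_pow_succ, Finset.mul_sum]
  rw [Finset.sum_comm]
  refine Finset.sum_congr rfl fun a _ => ?_
  rw [Finset.sum_comm]
  have hb (b : (ZMod q)ˣ) : ∑ χ : DirichletCharacter ℂ q,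
      χ c * (χ ((∏ j, (a j : ZMod q)) * b) * e ((∑ j, (a j : ZMod q)) + b)) =
        if b = (c * ∏ j, a j)⁻¹ then q.totient * e ((∑ j, (a j : ZMod q)) + b) else 0 := by
    have hiff : (c : ZMod q) * ((∏ j, (a j : ZMod q)) * b) = 1 ↔ b = (c * ∏ j, a j)⁻¹ := by
      rw [eq_inv_iff_mul_eq_one, mul_comm b, ← Units.val_inj]
      simp [mul_assoc]
    simp only [← mul_assoc, ← map_mul, ← Finset.sum_mul]
    rw [sum_characters_eq, ite_mul, zero_mul]
    simp only [mul_assoc, hiff]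
  simp only [hb, Finset.sum_ite_eq', Finset.mem_univ, if_true]

lemma isPrimitive_iff_ne_one_of_prime {q : ℕ} (hq : q.Prime) (χ : DirichletCharacter ℂ q) :
    χ.IsPrimitive ↔ χ ≠ 1 := by
  have : NeZero q := ⟨hq.ne_zero⟩
  rw [Ne, eq_one_iff_conductor_eq_one, isPrimitive_def]
  rcases (Nat.dvd_prime hq).1 χ.conductor_dvd_level with h | h
  · simp [h, hq.ne_one.symm]
  · simp [h, hq.ne_one]

open scoped Classical in
lemma sum_even_eq {q : ℕ} [NeZero q] (f : DirichletCharacter ℂ q → ℂ) :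
    ∑ χ : DirichletCharacter ℂ q with χ (-1) = 1, f χ =
      (1 / 2) * ∑ ℓ ∈ Finset.range 2, ∑ χ : DirichletCharacter ℂ q, χ (-1) ^ ℓ * f χ := by
  rw [Finset.sum_comm, Finset.mul_sum, Finset.sum_filter]
  refine Finset.sum_congr rfl fun χ _ => ?_
  rcases χ.even_or_odd with h | h
  · have h' : χ (-1) = 1 := h
    rw [h', if_pos rfl]
    simp
  · have h' : χ (-1) = -1 := h
    rw [h', if_neg (by norm_num)]
    simp [Finset.sum_range_succ]

open scoped Classical in
lemma sum_even_primitive_eq {q : ℕ} [NeZero q] (hq : q.Prime) (f : DirichletCharacter ℂ q → ℂ) :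
    ∑ χ : DirichletCharacter ℂ q with χ.IsPrimitive ∧ χ (-1) = 1, f χ =
      ∑ χ : DirichletCharacter ℂ q with χ (-1) = 1, f χ - f 1 := by
  have h1 : (1 : DirichletCharacter ℂ q) ∈
      (Finset.univ.filter fun χ : DirichletCharacter ℂ q => χ (-1) = 1) := by
    simp [MulChar.one_apply (isUnit_one.neg : IsUnit (-1 : ZMod q))]
  rw [← Finset.sum_erase_eq_sub h1]
  refine Finset.sum_congr ?_ fun _ _ => rfl
  ext χ
  simp [isPrimitive_iff_ne_one_of_prime hq]

open scoped Classical in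
/-- the identity expressing `Σ⁺_{χ mod q} (ε(χ)ε(χψ))^k` in terms of
`(2k−1)`-dimensional Kloosterman-type sums. -/
theorem sum_eps_pow_eq_kloosterman (k : ℕ) (hk : 0 < k)
    (D : ℕ) [NeZero D] (hD : 1 < D) (hDsf : Squarefree D) (hD4 : D % 4 = 1)
    (ψ : DirichletCharacter ℂ D) (hψprim : ψ.IsPrimitive) (hψquad : ψ ^ 2 = 1) (hψ1 : ψ ≠ 1)
    (q : ℕ) [NeZero q] (hq : q.Prime) (hq2 : q ≠ 2) (hqD : ¬ q ∣ D) :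
    ∑ χ ∈ Finset.univ.filter
        (fun χ : DirichletCharacter ℂ q => χ.IsPrimitive ∧ χ (-1) = 1),
        (epsChar χ * epsChar (prodChar χ ψ)) ^ k =
      (ψ (q : ZMod D)) ^ k * (epsChar ψ) ^ k * (Nat.totient q : ℂ) / (2 * (q : ℂ) ^ k) *
        ∑ ℓ ∈ Finset.range 2, ∑ a : Fin (2 * k - 1) → (ZMod q)ˣ,
          eZMod q ((∑ j, (a j : ZMod q)) +
            (-1) ^ ℓ * ((D : ZMod q) ^ k * ∏ j, (a j : ZMod q))⁻¹) -
      (ψ (q : ZMod D)) ^ k * (epsChar ψ) ^ k / (q : ℂ) ^ k := by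
  have hcop : q.Coprime D := (Nat.Prime.coprime_iff_not_dvd hq).2 hqD
  have : Fact q.Prime := ⟨hq⟩
  obtain ⟨d, hd⟩ : IsUnit (D : ZMod q) := (ZMod.isUnit_iff_coprime _ _).2 hcop.symm
  obtain ⟨m, hm⟩ : ∃ m, 2 * k = m + 1 := ⟨2 * k - 1, by omega⟩
  have hm' : 2 * k - 1 = m := by omega
  have htriv : (1 : DirichletCharacter ℂ q) D ^ k *
      gaussSum (1 : DirichletCharacter ℂ q) ZMod.stdAddChar ^ (m + 1) = 1 := by
    have hne : (ZMod.stdAddChar : AddChar (ZMod q) ℂ) ≠ 1 := by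
      intro h
      have h1 : (1 : ZMod q) = 0 := ZMod.injective_stdAddChar (N := q) (by simp [h])
      exact one_ne_zero h1
    rw [gaussSum_one_left hne, ← hm, pow_mul, ← hd, MulChar.one_apply_coe]
    simp
  have hsum (ℓ : ℕ) : ∑ χ : DirichletCharacter ℂ q,
      χ (-1) ^ ℓ * (χ D ^ k * gaussSum χ ZMod.stdAddChar ^ (m + 1)) =
        q.totient * ∑ a : Fin m → (ZMod q)ˣ, eZMod q ((∑ j, (a j : ZMod q)) +
          (-1) ^ ℓ * ((D : ZMod q) ^ k * ∏ j, (a j : ZMod q))⁻¹) := by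
    convert sum_char_mul_gaussSum_pow ((-1) ^ ℓ * d ^ k) m
      (ZMod.stdAddChar : AddChar (ZMod q) ℂ) using 2
    · simp [hd, mul_assoc]
    · refine Finset.sum_congr rfl fun a _ => ?_
      rw [eZMod_eq_stdAddChar]
      congr 2
      have hneg : (((-1) ^ ℓ : (ZMod q)ˣ) : ZMod q)⁻¹ = (-1) ^ ℓ := by simp [← inv_pow]
      rw [Units.val_inv_eq_inv_val, mul_assoc, Units.val_mul,
        mul_inv (((-1) ^ ℓ : (ZMod q)ˣ) : ZMod q), hneg]
      simp [hd]
  simp only [epsChar_mul_epsChar_prodChar_pow hcop]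
  rw [← Finset.mul_sum, sum_even_primitive_eq hq, hm', hm, htriv, sum_even_eq]
  simp only [hsum]
  rw [← Finset.mul_sum]
  ring
end
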